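/- arXiv:2204.01310 — 3 statements merged into one kernel-verified Lean document; each statement's English description precedes it below -/
import Mathlib

section
/- For n ≥ 2, let (D_n, S) be the Coxeter system with S = {s_1,…,s_n}, where m(s_i,s_{i+1}) = 3 for 1 ≤ i ≤ n−2, m(s_n,s_{n−2}) = 3 (when n ≥ 3), and m(s_i,s_j) = 2 for all other pairs i ≠ j (so D_2 is generated by two commuting generators). Let D_{n,k,l} be the number of subsets J ⊆ S with |J| = k and ℓ(w0(J)) = l. Let T_D(x,y,z) = Σ_{n≥2} Σ_{k≥0} Σ_{l≥0} D_{n,k,l} x^n y^k z^l, P = Σ_{n≥0} x^n y^n z^{C(n+1,2)}, and R = Σ_{n≥2} x^n y^n z^{n²−n}, regarded as formal power series in x whose coefficients are polynomials in y and z. Then T_D(x,y,z) · (1 − x·P) = x²·P + 2x·(P − 1) + R. -/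
open Polynomial

namespace CoxeterCharPoly

variable {B W : Type*} [Group W] {M : CoxeterMatrix B}

/-- The left weak order on a Coxeter group. -/
def wle (cs : CoxeterSystem M W) (u w : W) : Prop :=
  cs.length w = cs.length (w * u⁻¹) + cs.length u

/-- The standard parabolic subgroup generated by `J ⊆ S`. -/
def parabolic (cs : CoxeterSystem M W) (J : Set B) : Subgroup W :=
  Subgroup.closure (cs.simple '' J)

/- The longest element of the parabolic subgroup `W_J` (junk value if there is
no element of maximal length). -/
open Classical in
noncomputable def w0 (cs : CoxeterSystem M W) (J : Set B) : W :=
  if h : ∃ w ∈ parabolic cs J, ∀ u ∈ parabolic cs J, cs.length u ≤ cs.length w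
  then h.choose else 1

/-- The right descent set of `w`, as a subset of `B`. -/
def rightDescents (cs : CoxeterSystem M W) (w : W) : Set B :=
  {i | cs.IsRightDescent w i}

/- `μ` is the Möbius function of the subposet `A` of the order `le`. -/
open Classical in
def IsMobiusOn {α : Type*} (le : α → α → Prop) (A : Set α) (μ : α → α → ℤ) : Prop :=
  ∀ a ∈ A, ∀ b ∈ A, le a b →
    (∑ᶠ t ∈ {t | t ∈ A ∧ le a t ∧ le t b}, μ a t) = if a = b then 1 else 0

/-- The Coxeter matrix of type `Dₙ` (with `D₂` consisting of two commuting generators):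
generators `s₁, …, s_n` (here 0-indexed by `Fin n`), with `m(s_i, s_{i+1}) = 3` for
`1 ≤ i ≤ n-2`, `m(s_n, s_{n-2}) = 3` when `n ≥ 3`, and `m = 2` for all other pairs. -/
def Dmat (n : ℕ) : CoxeterMatrix (Fin n) where
  M := Matrix.of fun i j =>
    if i = j then 1
    else if (min (i : ℕ) (j : ℕ) + 1 = max (i : ℕ) (j : ℕ) ∧ max (i : ℕ) (j : ℕ) + 2 ≤ n)
        ∨ (min (i : ℕ) (j : ℕ) + 3 = n ∧ max (i : ℕ) (j : ℕ) + 1 = n) then 3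
    else 2
  isSymm := by
    ext i j
    simp only [Matrix.transpose_apply, Matrix.of_apply]
    by_cases h : i = j
    · subst h; rfl
    · rw [if_neg (Ne.symm h), if_neg h, min_comm, max_comm]
  diagonal := by intro i; simp
  off_diagonal := by
    intro i j h
    simp only [Matrix.of_apply, if_neg h]
    split <;> simp

/-- The length of the longest element of the standard parabolic subgroup `W_J` of the
Coxeter group of type `Dₙ`. -/
noncomputable def lenD (n : ℕ) (J : Finset (Fin n)) : ℕ :=
  (Dmat n).toCoxeterSystem.length
    (w0 (Dmat n).toCoxeterSystem (↑J : Set (Fin n)))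

/-- `D_{n,k,l}`: the number of subsets `J ⊆ S` with `|J| = k` and `ℓ(w0(J)) = l`
in the Coxeter system of type `Dₙ`. -/
noncomputable def Dcount (n k l : ℕ) : ℕ :=
  Nat.card {J : Finset (Fin n) // J.card = k ∧ lenD n J = l}

/-- The variable `y`, in the ring of polynomials in `y` and `z` over `ℤ`. -/
noncomputable def yv : Polynomial (Polynomial ℤ) := Polynomial.C Polynomial.X

/-- The variable `z`, in the ring of polynomials in `y` and `z` over `ℤ`. -/
noncomputable def zv : Polynomial (Polynomial ℤ) := Polynomial.X

/-- `T_D(x,y,z) = Σ_{n ≥ 2} Σ_{k,l ≥ 0} D_{n,k,l} x^n y^k z^l`, as a formal power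
series in `x` whose coefficients are polynomials in `y` and `z`. -/
noncomputable def TD : PowerSeries (Polynomial (Polynomial ℤ)) :=
  PowerSeries.mk fun n =>
    if n < 2 then 0
    else ∑ᶠ (k : ℕ), ∑ᶠ (l : ℕ), (Dcount n k l : Polynomial (Polynomial ℤ)) * yv ^ k * zv ^ l

/-- `P = Σ_{n ≥ 0} x^n y^n z^(C(n+1,2))`. -/
noncomputable def Pser : PowerSeries (Polynomial (Polynomial ℤ)) :=
  PowerSeries.mk fun n => yv ^ n * zv ^ ((n + 1).choose 2)

/-- `R = Σ_{n ≥ 2} x^n y^n z^(n² - n)`. -/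
noncomputable def Rser : PowerSeries (Polynomial (Polynomial ℤ)) :=
  PowerSeries.mk fun n => if n < 2 then 0 else yv ^ n * zv ^ (n ^ 2 - n)

section UpperBound

/-- Adjacency of `i < j` in the Coxeter graph of type `D`, numbered from the fork: the two
prongs are `0` and `1`, both attached to `2`, and `2, 3, 4, …` is a path. -/
def ForkAdj (i j : ℕ) : Prop := (1 ≤ i ∧ j = i + 1) ∨ (i = 0 ∧ j = 2)

/-- The elements `t i`, `i ∈ J`, satisfy the relations of type `D`. -/
structure ForkRel {G : Type*} [Group G] (t : ℕ → G) (J : Finset ℕ) : Prop where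
  sq : ∀ i ∈ J, t i * t i = 1
  comm : ∀ i ∈ J, ∀ j ∈ J, i < j → ¬ ForkAdj i j → t i * t j = t j * t i
  braid : ∀ i ∈ J, ∀ j ∈ J, i < j → ForkAdj i j → t i * t j * t i = t j * t i * t j

/-- The number of positive roots with leading coordinate `j` in the parabolic root subsystem
of `J`. -/
def leadCount (J : Finset ℕ) : ℕ → ℕ
  | 0 => 0
  | 1 => (if 0 ∈ J then 1 else 0) + (if 1 ∈ J then 1 else 0)
  | j + 2 => if j + 2 ∈ J then
      leadCount J (j + 1) + (if Finset.range (j + 2) ⊆ J then 2 else 1) else 0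

theorem leadCount_of_range_subset {J : Finset ℕ} :
    ∀ j, Finset.range (j + 2) ⊆ J → leadCount J (j + 1) = 2 * (j + 1)
  | 0, h => by
      have h0 : 0 ∈ J := h (by simp)
      have h1 : 1 ∈ J := h (by simp)
      simp [leadCount, h0, h1]
  | j + 1, h => by
      have h' : Finset.range (j + 2) ⊆ J :=
        (Finset.range_subset_range.2 (by omega)).trans h
      have h2 : j + 2 ∈ J := h (by simp)
      rw [leadCount, if_pos h2, if_pos h', leadCount_of_range_subset j h']
      ring

variable {G : Type*} [Group G] (t : ℕ → G) (J : Finset ℕ)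

/-- The subgroup generated by the `t i` with `i ∈ J`, `i ≤ j`, trivial for `j = 0`. -/
def initialParabolic (j : ℕ) : Subgroup G :=
  Subgroup.closure (t '' {i | i ∈ J ∧ i ≤ j ∧ 1 ≤ j})

/-- The element acting as the sign change of the coordinates `0` and `j`. -/
def signFlip : ℕ → G
  | 0 => 1
  | 1 => t 1 * t 0
  | j + 2 => t (j + 2) * signFlip (j + 1) * t (j + 2)

/-- Representatives of the right cosets of `initialParabolic t J (j - 1)` in
`initialParabolic t J j`. -/
def cosetReps : ℕ → Set G
  | 0 => {1}
  | 1 => {x | x = 1 ∨ (0 ∈ J ∧ x = t 0) ∨ (1 ∈ J ∧ x = t 1) ∨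
      (0 ∈ J ∧ 1 ∈ J ∧ x = t 1 * t 0)}
  | j + 2 => {x | x = 1 ∨ (j + 2 ∈ J ∧ ((∃ y ∈ cosetReps (j + 1), x = t (j + 2) * y) ∨
      (Finset.range (j + 2) ⊆ J ∧ x = signFlip t (j + 2))))}

variable {t J}

theorem mem_initialParabolic {i j : ℕ} (hi : i ∈ J) (hij : i ≤ j) (hj : 1 ≤ j) :
    t i ∈ initialParabolic t J j :=
  Subgroup.subset_closure ⟨i, ⟨hi, hij, hj⟩, rfl⟩

theorem initialParabolic_mono (j : ℕ) :
    initialParabolic t J j ≤ initialParabolic t J (j + 1) :=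
  Subgroup.closure_mono (Set.image_mono fun _ h => ⟨h.1, by have := h.2; omega, by omega⟩)

theorem ForkRel.commute (hr : ForkRel t J) {j : ℕ} (hj : j + 2 ∈ J) {g : G}
    (hg : g ∈ initialParabolic t J j) : t (j + 2) * g = g * t (j + 2) := by
  induction hg using Subgroup.closure_induction with
  | mem x hx =>
    obtain ⟨i, ⟨hi, hij, h1⟩, rfl⟩ := hx
    exact (hr.comm i hi _ hj (by omega) (by unfold ForkAdj; omega)).symm
  | one => simp
  | mul x y _ _ hx hy => rw [← mul_assoc, hx, mul_assoc, hy, mul_assoc]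
  | inv x _ hx => exact (Commute.inv_right (show Commute (t (j + 2)) x from hx))

theorem signFlip_mem : ∀ j, Finset.range (j + 1) ⊆ J → signFlip t j ∈ initialParabolic t J j
  | 0, _ => one_mem _
  | 1, h => mul_mem (mem_initialParabolic (h (by simp)) le_rfl le_rfl)
      (mem_initialParabolic (h (by simp)) (by simp) le_rfl)
  | j + 2, h => by
      have h2 : t (j + 2) ∈ initialParabolic t J (j + 2) :=
        mem_initialParabolic (h (by simp)) le_rfl (by omega)
      exact mul_mem (mul_mem h2 (initialParabolic_mono _ (signFlip_mem (j + 1)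
        ((Finset.range_subset_range.2 (by omega)).trans h)))) h2

theorem one_mem_cosetReps : ∀ j, (1 : G) ∈ cosetReps t J j
  | 0 => rfl
  | 1 => Or.inl rfl
  | _ + 2 => Or.inl rfl

theorem cosetReps_subset : ∀ j, ∀ x ∈ cosetReps t J j, x ∈ initialParabolic t J j
  | 0, x, hx => by
      obtain rfl : x = 1 := hx
      exact one_mem _
  | 1, x, hx => by
      rcases hx with rfl | ⟨h, rfl⟩ | ⟨h, rfl⟩ | ⟨h0, h1, rfl⟩
      · exact one_mem _
      · exact mem_initialParabolic h (by omega) le_rfl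
      · exact mem_initialParabolic h (by omega) le_rfl
      · exact mul_mem (mem_initialParabolic h1 le_rfl le_rfl)
          (mem_initialParabolic h0 (by simp) le_rfl)
  | j + 2, x, hx => by
      rcases hx with rfl | ⟨h, ⟨y, hy, rfl⟩ | ⟨h', rfl⟩⟩
      · exact one_mem _
      · exact mul_mem (mem_initialParabolic h le_rfl (by omega))
          (initialParabolic_mono _ (cosetReps_subset _ y hy))
      · refine signFlip_mem _ ?_
        rw [Finset.range_add_one]
        exact Finset.insert_subset h h'

theorem signFlip_mem_cosetReps (j : ℕ) (h : Finset.range (j + 2) ⊆ J) :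
    signFlip t (j + 1) ∈ cosetReps t J (j + 1) := by
  cases j with
  | zero => exact Or.inr (Or.inr (Or.inr ⟨h (by simp), h (by simp), rfl⟩))
  | succ j => exact Or.inr ⟨h (by simp), Or.inr
      ⟨(Finset.range_subset_range.2 (by omega)).trans h, rfl⟩⟩

theorem ForkRel.signFlip_mul (hr : ForkRel t J) :
    ∀ j, Finset.range (j + 3) ⊆ J → ∀ s < j + 2,
      signFlip t (j + 2) * t s = t (Equiv.swap 0 1 s) * signFlip t (j + 2)
  | 0, h, s, hs => by
      have h0 : 0 ∈ J := h (by simp)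
      have h1 : 1 ∈ J := h (by simp)
      have h2 : 2 ∈ J := h (by simp)
      have c01 := hr.comm 0 h0 1 h1 (by omega) (by unfold ForkAdj; omega)
      have b0 := hr.braid 0 h0 2 h2 (by omega) (by unfold ForkAdj; omega)
      have b1 := hr.braid 1 h1 2 h2 (by omega) (by unfold ForkAdj; omega)
      obtain rfl | rfl : s = 0 ∨ s = 1 := by omega
      · rw [Equiv.swap_apply_left]
        calc t 2 * (t 1 * t 0) * t 2 * t 0
            = t 2 * t 1 * (t 0 * t 2 * t 0) := by group
          _ = t 2 * t 1 * t 2 * t 0 * t 2 := by rw [b0]; group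
          _ = t 1 * (t 2 * (t 1 * t 0) * t 2) := by rw [← b1]; group
      · rw [Equiv.swap_apply_right]
        calc t 2 * (t 1 * t 0) * t 2 * t 1
            = t 2 * t 0 * (t 1 * t 2 * t 1) := by rw [← c01]; group
          _ = t 2 * t 0 * t 2 * t 1 * t 2 := by rw [b1]; group
          _ = t 0 * (t 2 * (t 0 * t 1) * t 2) := by rw [← b0]; group
          _ = t 0 * (t 2 * (t 1 * t 0) * t 2) := by rw [c01]
  | j + 1, h, s, hs => by
      have hle : Finset.range (j + 3) ⊆ J :=
        (Finset.range_subset_range.2 (by omega)).trans h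
      have hm : ∀ i < j + 4, i ∈ J := fun i hi => h (Finset.mem_range.2 hi)
      rcases Nat.lt_or_ge s (j + 2) with hs' | hs'
      · have ih := hr.signFlip_mul j hle s hs'
        have e : ∀ i < j + 2, t (j + 3) * t i = t i * t (j + 3) := fun i hi =>
          (hr.comm i (hm i (by omega)) _ (hm (j + 3) (by omega)) (by omega)
            (by unfold ForkAdj; omega)).symm
        have hsw : Equiv.swap 0 1 s < j + 2 := by
          rw [Equiv.swap_apply_def]; split_ifs <;> omega
        calc t (j + 3) * signFlip t (j + 2) * t (j + 3) * t s
            = t (j + 3) * (signFlip t (j + 2) * t s) * t (j + 3) := by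
              rw [mul_assoc, e s hs']; group
          _ = t (j + 3) * t (Equiv.swap 0 1 s) * signFlip t (j + 2) * t (j + 3) := by
              rw [ih]; group
          _ = t (Equiv.swap 0 1 s) * (t (j + 3) * signFlip t (j + 2) * t (j + 3)) := by
              rw [e _ hsw]; group
      · obtain rfl : s = j + 2 := by omega
        rw [Equiv.swap_apply_of_ne_of_ne (by omega) (by omega)]
        have b := hr.braid (j + 2) (hm _ (by omega)) (j + 3) (hm _ (by omega)) (by omega)
          (by unfold ForkAdj; omega)
        have hc : t (j + 3) * signFlip t (j + 1) = signFlip t (j + 1) * t (j + 3) :=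
          hr.commute (hm _ (by omega)) (signFlip_mem (j + 1)
            ((Finset.range_subset_range.2 (by omega)).trans h))
        calc t (j + 3) * (t (j + 2) * signFlip t (j + 1) * t (j + 2)) * t (j + 3) * t (j + 2)
            = t (j + 3) * t (j + 2) * signFlip t (j + 1) *
                (t (j + 2) * t (j + 3) * t (j + 2)) := by group
          _ = t (j + 3) * t (j + 2) * (signFlip t (j + 1) * t (j + 3)) *
                t (j + 2) * t (j + 3) := by rw [b]; group
          _ = t (j + 3) * t (j + 2) * t (j + 3) * signFlip t (j + 1) *
                t (j + 2) * t (j + 3) := by rw [← hc]; group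
          _ = t (j + 2) * (t (j + 3) * (t (j + 2) * signFlip t (j + 1) * t (j + 2)) *
                t (j + 3)) := by rw [← b]; group

theorem ForkRel.cosetReps_mul (hr : ForkRel t J) :
    ∀ j, ∀ x ∈ cosetReps t J (j + 1), ∀ s ∈ J, s ≤ j + 1 →
      ∃ h ∈ initialParabolic t J j, ∃ y ∈ cosetReps t J (j + 1), x * t s = h * y
  | 0, x, hx, s, hs, hs1 => by
      refine ⟨1, one_mem _, x * t s, ?_, by simp⟩
      have hc : ∀ h0 : 0 ∈ J, ∀ h1 : 1 ∈ J, t 0 * t 1 = t 1 * t 0 := fun h0 h1 =>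
        hr.comm 0 h0 1 h1 (by omega) (by unfold ForkAdj; omega)
      obtain rfl | rfl : s = 0 ∨ s = 1 := by omega
      · rcases hx with rfl | ⟨h, rfl⟩ | ⟨h, rfl⟩ | ⟨h0, h1, rfl⟩
        · exact Or.inr (Or.inl ⟨hs, one_mul _⟩)
        · exact Or.inl (hr.sq _ h)
        · exact Or.inr (Or.inr (Or.inr ⟨hs, h, rfl⟩))
        · exact Or.inr (Or.inr (Or.inl ⟨h1, by rw [mul_assoc, hr.sq _ h0, mul_one]⟩))
      · rcases hx with rfl | ⟨h, rfl⟩ | ⟨h, rfl⟩ | ⟨h0, h1, rfl⟩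
        · exact Or.inr (Or.inr (Or.inl ⟨hs, one_mul _⟩))
        · exact Or.inr (Or.inr (Or.inr ⟨h, hs, hc h hs⟩))
        · exact Or.inl (hr.sq _ h)
        · exact Or.inr (Or.inl ⟨h0, by
            rw [← hc h0 h1, mul_assoc, hr.sq _ h1, mul_one]⟩)
  | j + 1, x, hx, s, hs, hs1 => by
      rcases hx with rfl | ⟨hj, ⟨y, hy, rfl⟩ | ⟨hfull, rfl⟩⟩
      · rcases Nat.lt_or_ge s (j + 2) with h | h
        · exact ⟨t s, mem_initialParabolic hs (by omega) (by omega), 1, one_mem_cosetReps _,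
            by simp⟩
        · obtain rfl : s = j + 2 := by omega
          exact ⟨1, one_mem _, t (j + 2), Or.inr ⟨hs, Or.inl ⟨1, one_mem_cosetReps _,
            by simp⟩⟩, rfl⟩
      · rcases Nat.lt_or_ge s (j + 2) with h | h
        · obtain ⟨g, hg, z, hz, e⟩ := hr.cosetReps_mul j y hy s hs (by omega)
          refine ⟨g, initialParabolic_mono _ hg, t (j + 2) * z,
            Or.inr ⟨hj, Or.inl ⟨z, hz, rfl⟩⟩, ?_⟩
          rw [mul_assoc, e, ← mul_assoc, hr.commute hj hg, mul_assoc]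
        · obtain rfl : s = j + 2 := by omega
          have braid_case : ∀ i ∈ J, i ≤ j + 1 → ForkAdj i (j + 2) →
              ∀ z, t i * z ∈ cosetReps t J (j + 1) → t (j + 2) * z = z * t (j + 2) →
              ∃ h ∈ initialParabolic t J (j + 1), ∃ y ∈ cosetReps t J (j + 2),
                t (j + 2) * (t i * z) * t (j + 2) = h * y := by
            intro i hi hij ha z hz hzc
            refine ⟨t i, mem_initialParabolic hi hij (by omega), t (j + 2) * (t i * z),
              Or.inr ⟨hj, Or.inl ⟨_, hz, rfl⟩⟩, ?_⟩
            have b := hr.braid i hi _ hj (by omega) ha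
            calc t (j + 2) * (t i * z) * t (j + 2)
                = t (j + 2) * t i * (z * t (j + 2)) := by group
              _ = t (j + 2) * t i * t (j + 2) * z := by rw [← hzc]; group
              _ = t i * (t (j + 2) * (t i * z)) := by rw [← b]; group
          have one_case : ∃ h ∈ initialParabolic t J (j + 1), ∃ y ∈ cosetReps t J (j + 2),
                t (j + 2) * 1 * t (j + 2) = h * y :=
            ⟨1, one_mem _, 1, one_mem_cosetReps _, by rw [mul_one, hr.sq _ hj, one_mul]⟩
          have flip_case : Finset.range (j + 2) ⊆ J →
              ∃ h ∈ initialParabolic t J (j + 1), ∃ y ∈ cosetReps t J (j + 2),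
                t (j + 2) * signFlip t (j + 1) * t (j + 2) = h * y := fun hf =>
            ⟨1, one_mem _, signFlip t (j + 2), Or.inr ⟨hj, Or.inr ⟨hf, rfl⟩⟩,
              by rw [one_mul]; rfl⟩
          cases j with
          | zero =>
            rcases hy with rfl | ⟨h0, rfl⟩ | ⟨h1, rfl⟩ | ⟨h0, h1, rfl⟩
            · exact one_case
            · simpa using braid_case 0 h0 (by omega) (by unfold ForkAdj; omega) 1
                (by simp [cosetReps, h0]) (by simp)
            · simpa using braid_case 1 h1 (by omega) (by unfold ForkAdj; omega) 1
                (by simp [cosetReps, h1]) (by simp)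
            · refine flip_case fun i hi => ?_
              obtain rfl | rfl : i = 0 ∨ i = 1 := by
                have := Finset.mem_range.1 hi; omega
              exacts [h0, h1]
          | succ j =>
            rcases hy with rfl | ⟨hj1, ⟨z, hz, rfl⟩ | ⟨hf, rfl⟩⟩
            · exact one_case
            · exact braid_case (j + 2) hj1 (by omega) (by unfold ForkAdj; omega) z
                (Or.inr ⟨hj1, Or.inl ⟨z, hz, rfl⟩⟩)
                (hr.commute hj (cosetReps_subset _ z hz))
            · refine flip_case ?_
              rw [Finset.range_add_one]
              exact Finset.insert_subset hj1 hf
      · rcases Nat.lt_or_ge s (j + 2) with h | h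
        · have hsw : Equiv.swap 0 1 s < j + 2 := by
            rw [Equiv.swap_apply_def]; split_ifs <;> omega
          refine ⟨_, mem_initialParabolic (hfull (Finset.mem_range.2 hsw)) (by omega)
            (by omega), signFlip t (j + 2), Or.inr ⟨hj, Or.inr ⟨hfull, rfl⟩⟩,
            hr.signFlip_mul j ?_ s h⟩
          rw [Finset.range_add_one]
          exact Finset.insert_subset hj hfull
        · obtain rfl : s = j + 2 := by omega
          refine ⟨1, one_mem _, t (j + 2) * signFlip t (j + 1), Or.inr ⟨hj, Or.inl
            ⟨_, signFlip_mem_cosetReps j hfull, rfl⟩⟩, ?_⟩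
          rw [signFlip, mul_assoc, hr.sq _ hj, mul_one, one_mul]

theorem ForkRel.exists_mul_of_mem (hr : ForkRel t J) (j : ℕ) {g : G}
    (hg : g ∈ initialParabolic t J (j + 1)) :
    ∃ h ∈ initialParabolic t J j, ∃ y ∈ cosetReps t J (j + 1), g = h * y := by
  have step : ∀ (x : G) (s : ℕ), s ∈ J → s ≤ j + 1 →
      (∃ h ∈ initialParabolic t J j, ∃ y ∈ cosetReps t J (j + 1), x = h * y) →
      ∃ h ∈ initialParabolic t J j, ∃ y ∈ cosetReps t J (j + 1), x * t s = h * y := by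
    rintro x s hs hsj ⟨h, hh, y, hy, rfl⟩
    obtain ⟨h', hh', y', hy', e⟩ := hr.cosetReps_mul j y hy s hs hsj
    exact ⟨h * h', mul_mem hh hh', y', hy', by rw [mul_assoc, e, mul_assoc]⟩
  induction hg using Subgroup.closure_induction_right with
  | one => exact ⟨1, one_mem _, 1, one_mem_cosetReps _, by simp⟩
  | mul_right x _ y hy ih =>
    obtain ⟨s, ⟨hs, hsj, -⟩, rfl⟩ := hy
    exact step x s hs hsj ih
  | mul_inv_cancel x _ y hy ih =>
    obtain ⟨s, ⟨hs, hsj, -⟩, rfl⟩ := hy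
    rw [inv_eq_of_mul_eq_one_left (hr.sq s hs)]
    exact step x s hs hsj ih

variable {len : G → ℕ}

theorem len_signFlip_le (h1 : len 1 = 0) (hmul : ∀ g h, len (g * h) ≤ len g + len h)
    (hgen : ∀ i ∈ J, len (t i) ≤ 1) :
    ∀ j, Finset.range (j + 1) ⊆ J → len (signFlip t j) ≤ 2 * j
  | 0, _ => by simp [signFlip, h1]
  | 1, h => by
      have := hmul (t 1) (t 0)
      have := hgen 0 (h (by simp))
      have := hgen 1 (h (by simp))
      simp only [signFlip]
      omega
  | j + 2, h => by
      have := len_signFlip_le h1 hmul hgen (j + 1)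
        ((Finset.range_subset_range.2 (by omega)).trans h)
      have := hgen (j + 2) (h (by simp))
      have := hmul (t (j + 2) * signFlip t (j + 1)) (t (j + 2))
      have := hmul (t (j + 2)) (signFlip t (j + 1))
      simp only [signFlip]
      omega

theorem len_cosetReps_le (h1 : len 1 = 0) (hmul : ∀ g h, len (g * h) ≤ len g + len h)
    (hgen : ∀ i ∈ J, len (t i) ≤ 1) :
    ∀ j, ∀ x ∈ cosetReps t J j, len x ≤ leadCount J j
  | 0, x, hx => by
      obtain rfl : x = 1 := hx
      omega
  | 1, x, hx => by
      rcases hx with rfl | ⟨h, rfl⟩ | ⟨h, rfl⟩ | ⟨h0, h1, rfl⟩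
      · omega
      · have := hgen 0 h
        simp only [leadCount, h, if_true]
        omega
      · have := hgen 1 h
        simp only [leadCount, h, if_true]
        omega
      · have := hgen 0 h0
        have := hgen 1 h1
        have := hmul (t 1) (t 0)
        simp only [leadCount, h0, h1, if_true]
        omega
  | j + 2, x, hx => by
      rcases hx with rfl | ⟨h, ⟨y, hy, rfl⟩ | ⟨h', rfl⟩⟩
      · omega
      · have := len_cosetReps_le h1 hmul hgen (j + 1) y hy
        have := hgen _ h
        have := hmul (t (j + 2)) y
        rw [leadCount, if_pos h]
        split_ifs <;> omega
      · have h3 : Finset.range (j + 1 + 2) ⊆ J := by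
          rw [Finset.range_add_one]
          exact Finset.insert_subset h h'
        rw [leadCount_of_range_subset (j + 1) h3]
        exact len_signFlip_le h1 hmul hgen (j + 2) h3

theorem ForkRel.len_le (hr : ForkRel t J) (h1 : len 1 = 0)
    (hmul : ∀ g h, len (g * h) ≤ len g + len h) (hgen : ∀ i ∈ J, len (t i) ≤ 1) (j : ℕ) :
    ∀ g ∈ initialParabolic t J j, len g ≤ ∑ i ∈ Finset.range (j + 1), leadCount J i := by
  induction j with
  | zero =>
    intro g hg
    have : initialParabolic t J 0 = ⊥ := by simp [initialParabolic]
    rw [this, Subgroup.mem_bot] at hg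
    simp [hg, h1]
  | succ j ih =>
    intro g hg
    obtain ⟨h, hh, y, hy, rfl⟩ := hr.exists_mul_of_mem j hg
    rw [Finset.sum_range_succ]
    exact (hmul h y).trans
      (add_le_add (ih h hh) (len_cosetReps_le h1 hmul hgen _ y hy))

end UpperBound

section SignedPermutations

/-- The map on `ℤ` reflecting in the root `e_a - e_b`, where `e_{-a} = -e_a`. -/
def reflectFun (a b x : ℤ) : ℤ :=
  if x = a then b else if x = b then a else if x = -a then -b else if x = -b then -a else x

theorem reflectFun_involutive {a b : ℤ} (ha : a ≠ 0) (hb : b ≠ 0) (h : a ≠ b) (h' : a ≠ -b) :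
    Function.Involutive (reflectFun a b) := by
  intro x
  unfold reflectFun
  grind

theorem reflectFun_neg {a b : ℤ} (ha : a ≠ 0) (hb : b ≠ 0) (h : a ≠ b) (h' : a ≠ -b) (x : ℤ) :
    reflectFun a b (-x) = -reflectFun a b x := by
  unfold reflectFun
  grind

theorem reflectFun_fst (a b : ℤ) : reflectFun a b a = b := if_pos rfl

theorem reflectFun_snd (a b : ℤ) : reflectFun a b b = a := by
  unfold reflectFun
  split_ifs <;> omega

theorem reflectFun_of_ne {a b x : ℤ} (h1 : a ≠ x) (h2 : b ≠ x) (h3 : a ≠ -x) (h4 : b ≠ -x) :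
    reflectFun a b x = x := by
  unfold reflectFun
  split_ifs <;> omega

theorem apply_reflectFun {f : ℤ → ℤ} (hf : Function.Injective f) (hodd : ∀ x, f (-x) = -f x)
    (a b x : ℤ) : f (reflectFun a b x) = reflectFun (f a) (f b) (f x) := by
  unfold reflectFun
  rw [← hodd a, ← hodd b]
  simp only [hf.eq_iff]
  split_ifs <;> rfl

theorem reflectFun_comm {a b c d : ℤ} (hc : c ≠ 0) (hd : d ≠ 0) (hcd : c ≠ d) (hcd' : c ≠ -d)
    (hca : c ≠ a) (hca' : c ≠ -a) (hda : d ≠ a) (hda' : d ≠ -a)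
    (hcb : c ≠ b) (hcb' : c ≠ -b) (hdb : d ≠ b) (hdb' : d ≠ -b) (x : ℤ) :
    reflectFun c d (reflectFun a b x) = reflectFun a b (reflectFun c d x) := by
  rw [apply_reflectFun (reflectFun_involutive hc hd hcd hcd').injective
    (reflectFun_neg hc hd hcd hcd'), reflectFun_of_ne hca hda hca' hda',
    reflectFun_of_ne hcb hdb hcb' hdb']

theorem reflectFun_braid {a b c : ℤ} (ha : a ≠ 0) (hb : b ≠ 0) (hc : c ≠ 0)
    (hab : a ≠ b) (hab' : a ≠ -b) (hac : a ≠ c) (hac' : a ≠ -c) (hbc : b ≠ c) (hbc' : b ≠ -c)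
    (x : ℤ) :
    reflectFun a b (reflectFun c a (reflectFun a b x)) =
      reflectFun c a (reflectFun a b (reflectFun c a x)) := by
  have hca' : c ≠ -a := by omega
  have i1 := reflectFun_involutive ha hb hab hab'
  have i2 := reflectFun_involutive hc ha hac.symm hca'
  rw [apply_reflectFun i1.injective (reflectFun_neg ha hb hab hab'),
    apply_reflectFun i2.injective (reflectFun_neg hc ha hac.symm hca'), i1, i2,
    reflectFun_fst, reflectFun_snd, reflectFun_of_ne hac hbc hac' hbc',
    reflectFun_of_ne hbc.symm hab (by omega) hab']

/-- The `j`-th simple root is `e_a - e_b` with `a = rootFst j`, `b = rootSnd j`. -/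
def rootFst (j : ℕ) : ℤ := if j = 0 then 2 else j + 1

/-- The `j`-th simple root is `e_a - e_b` with `a = rootFst j`, `b = rootSnd j`. -/
def rootSnd (j : ℕ) : ℤ := if j = 0 then -1 else j

/-- The signed permutation of the `j`-th simple reflection of type `D`. -/
def signedSimple (j : ℕ) : Equiv.Perm ℤ :=
  (reflectFun_involutive (a := rootFst j) (b := rootSnd j)
    (by unfold rootFst; split_ifs <;> omega) (by unfold rootSnd; split_ifs <;> omega)
    (by unfold rootFst rootSnd; split_ifs <;> omega)
    (by unfold rootFst rootSnd; split_ifs <;> omega)).toPerm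

theorem signedSimple_apply (j : ℕ) (x : ℤ) :
    signedSimple j x = reflectFun (rootFst j) (rootSnd j) x := rfl

theorem signedSimple_apply_self (j : ℕ) (x : ℤ) : signedSimple j (signedSimple j x) = x :=
  (signedSimple j).left_inv x

theorem signedSimple_mul_self (j : ℕ) : signedSimple j * signedSimple j = 1 :=
  Equiv.ext (signedSimple_apply_self j)

theorem signedSimple_neg (j : ℕ) (x : ℤ) : signedSimple j (-x) = -signedSimple j x := by
  simp only [signedSimple_apply, reflectFun, rootFst, rootSnd]
  grind

theorem signedSimple_comm {i j : ℕ} (hij : i < j) (h : ¬ ForkAdj i j) :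
    signedSimple i * signedSimple j = signedSimple j * signedSimple i := by
  unfold ForkAdj at h
  ext x
  simp only [Equiv.Perm.mul_apply, signedSimple_apply]
  by_cases h01 : i = 0 ∧ j = 1
  · obtain ⟨rfl, rfl⟩ := h01
    unfold reflectFun rootFst rootSnd
    grind
  · apply reflectFun_comm <;> simp only [rootFst, rootSnd] <;> split_ifs <;> omega

theorem signedSimple_braid {i j : ℕ} (h : ForkAdj i j) :
    signedSimple i * signedSimple j * signedSimple i =
      signedSimple j * signedSimple i * signedSimple j := by
  unfold ForkAdj at h
  have hj : rootSnd j = rootFst i := by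
    unfold rootFst rootSnd; split_ifs <;> omega
  ext x
  simp only [Equiv.Perm.mul_apply, signedSimple_apply, hj]
  apply reflectFun_braid <;> simp only [rootFst, rootSnd] <;> split_ifs <;> omega

/-- The pairs `(a, b)` with `e_a - e_b` a positive root made negative by `w`. Each root
`e_a - e_b = e_{-b} - e_{-a}` is counted twice. -/
noncomputable def inversionPairs (n : ℕ) (w : Equiv.Perm ℤ) : Finset (ℤ × ℤ) :=
  {p ∈ Finset.Icc (-n : ℤ) n ×ˢ Finset.Icc (-n : ℤ) n |
    p.2 < p.1 ∧ p.1 ≠ 0 ∧ p.2 ≠ 0 ∧ p.1 + p.2 ≠ 0 ∧ w p.1 < w p.2}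

theorem mem_inversionPairs {n : ℕ} {w : Equiv.Perm ℤ} {x y : ℤ} :
    (x, y) ∈ inversionPairs n w ↔ ((-n ≤ x ∧ x ≤ n) ∧ (-n ≤ y ∧ y ≤ n)) ∧
      y < x ∧ x ≠ 0 ∧ y ≠ 0 ∧ x + y ≠ 0 ∧ w x < w y := by
  simp [inversionPairs]

theorem signedSimple_mem_Icc {n j : ℕ} (hn : 2 ≤ n) (hj : j < n) {x : ℤ}
    (hx : -n ≤ x ∧ x ≤ n) : -n ≤ signedSimple j x ∧ signedSimple j x ≤ n := by
  simp only [signedSimple_apply, reflectFun, rootFst, rootSnd]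
  split_ifs <;> omega

theorem signedSimple_ne_zero {j : ℕ} {x : ℤ} (hx : x ≠ 0) : signedSimple j x ≠ 0 := by
  simp only [signedSimple_apply, reflectFun, rootFst, rootSnd]
  split_ifs <;> omega

theorem signedSimple_add_ne_zero {j : ℕ} {x y : ℤ} (h : x + y ≠ 0) :
    signedSimple j x + signedSimple j y ≠ 0 := by
  intro h'
  have : signedSimple j x = signedSimple j (-y) := by rw [signedSimple_neg]; omega
  have := (signedSimple j).injective this
  omega

theorem signedSimple_lt {j : ℕ} {x y : ℤ} (hyx : y < x) (hx : x ≠ 0) (hy : y ≠ 0)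
    (hxy : x + y ≠ 0) (h1 : ¬ (x = rootFst j ∧ y = rootSnd j))
    (h2 : ¬ (x = -rootSnd j ∧ y = -rootFst j)) : signedSimple j y < signedSimple j x := by
  simp only [signedSimple_apply, reflectFun]
  unfold rootFst rootSnd at *
  split_ifs at * <;> omega

theorem map_mem_inversionPairs {n j : ℕ} (hn : 2 ≤ n) (hj : j < n) {w : Equiv.Perm ℤ}
    {x y : ℤ} (h : (x, y) ∈ inversionPairs n (w * signedSimple j))
    (h1 : ¬ (x = rootFst j ∧ y = rootSnd j)) (h2 : ¬ (x = -rootSnd j ∧ y = -rootFst j)) :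
    (signedSimple j x, signedSimple j y) ∈ inversionPairs n w := by
  rw [mem_inversionPairs] at h ⊢
  obtain ⟨⟨hx, hy⟩, hlt, hx0, hy0, hxy, hw⟩ := h
  exact ⟨⟨signedSimple_mem_Icc hn hj hx, signedSimple_mem_Icc hn hj hy⟩,
    signedSimple_lt hlt hx0 hy0 hxy h1 h2, signedSimple_ne_zero hx0, signedSimple_ne_zero hy0,
    signedSimple_add_ne_zero hxy, hw⟩

theorem card_inversionPairs_mul_le {n j : ℕ} (hn : 2 ≤ n) (hj : j < n) (w : Equiv.Perm ℤ) :
    (inversionPairs n (w * signedSimple j)).card ≤ (inversionPairs n w).card + 2 := by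
  set S : Finset (ℤ × ℤ) := {(rootFst j, rootSnd j), (-rootSnd j, -rootFst j)}
  have hS : S.card ≤ 2 := Finset.card_le_two
  have h1 : (inversionPairs n (w * signedSimple j) \ S).card ≤ (inversionPairs n w).card := by
    refine Finset.card_le_card_of_injOn (Prod.map (signedSimple j) (signedSimple j)) ?_
      ((Prod.map_injective.2 ⟨(signedSimple j).injective,
        (signedSimple j).injective⟩).injOn)
    rintro ⟨x, y⟩ hp
    simp only [S, Finset.coe_sdiff, Set.mem_sdiff, Finset.mem_coe, Finset.mem_insert,
      Finset.mem_singleton, Prod.mk.injEq, not_or] at hp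
    exact map_mem_inversionPairs hn hj hp.1 hp.2.1 hp.2.2
  have := Finset.le_card_sdiff S (inversionPairs n (w * signedSimple j))
  omega

theorem card_inversionPairs_lt_mul {n j : ℕ} (hn : 2 ≤ n) (hj : j < n) {w : Equiv.Perm ℤ}
    (hodd : ∀ x, w (-x) = -w x) (h : w (rootSnd j) < w (rootFst j)) :
    (inversionPairs n w).card < (inversionPairs n (w * signedSimple j)).card := by
  have hf : signedSimple j (rootFst j) = rootSnd j := by simp [signedSimple_apply, reflectFun]
  have hs : signedSimple j (rootSnd j) = rootFst j := by
    rw [← hf, signedSimple_apply_self]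
  have hw : w * signedSimple j * signedSimple j = w := by
    rw [mul_assoc, signedSimple_mul_self, mul_one]
  have hmem : (rootFst j, rootSnd j) ∈ inversionPairs n (w * signedSimple j) := by
    rw [mem_inversionPairs, Equiv.Perm.mul_apply, Equiv.Perm.mul_apply, hf, hs]
    refine ⟨?_, ?_, ?_, ?_, ?_, h⟩ <;> simp only [rootFst, rootSnd] <;>
      split_ifs <;> omega
  refine lt_of_le_of_lt ?_ (Finset.card_erase_lt_of_mem hmem)
  refine Finset.card_le_card_of_injOn (Prod.map (signedSimple j) (signedSimple j)) ?_
    ((Prod.map_injective.2 ⟨(signedSimple j).injective, (signedSimple j).injective⟩).injOn)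
  rintro ⟨x, y⟩ hp
  have hp' : (x, y) ∈ inversionPairs n w := hp
  have hlt := (mem_inversionPairs.1 hp').2.2.2.2.2
  rw [Finset.mem_coe, Finset.mem_erase]
  constructor
  · intro e
    have e1 : signedSimple j x = rootFst j := congrArg Prod.fst e
    have e2 : signedSimple j y = rootSnd j := congrArg Prod.snd e
    have e1' : x = rootSnd j := by rw [← signedSimple_apply_self j x, e1, hf]
    have e2' : y = rootFst j := by rw [← signedSimple_apply_self j y, e2, hs]
    have := (mem_inversionPairs.1 hp').2.1
    rw [e1', e2'] at this
    unfold rootFst rootSnd at this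
    split_ifs at this <;> omega
  · refine map_mem_inversionPairs hn hj (by rwa [hw]) ?_ ?_
    · rintro ⟨rfl, rfl⟩
      omega
    · rintro ⟨rfl, rfl⟩
      rw [hodd, hodd] at hlt
      omega

/-- The `b` with `e_j - e_b` a positive root with leading coordinate `j` made negative
by `w`. -/
noncomputable def leadInversions (w : Equiv.Perm ℤ) (j : ℕ) : Finset ℤ :=
  {b ∈ Finset.Icc (-j : ℤ) j | b ≠ 0 ∧ b ≠ j ∧ b ≠ -j ∧ w j < w b}

theorem mem_leadInversions {w : Equiv.Perm ℤ} {j : ℕ} {b : ℤ} :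
    b ∈ leadInversions w j ↔
      (-(j : ℤ) ≤ b ∧ b ≤ j) ∧ b ≠ 0 ∧ b ≠ j ∧ b ≠ -j ∧ w j < w b := by
  simp [leadInversions]

theorem two_mul_sum_card_leadInversions_le (n : ℕ) {w : Equiv.Perm ℤ}
    (hodd : ∀ x, w (-x) = -w x) :
    2 * ∑ j ∈ Finset.range n, (leadInversions w (j + 1)).card ≤ (inversionPairs n w).card := by
  rw [← Finset.card_sigma, two_mul, ← Finset.card_disjSum]
  refine Finset.card_le_card_of_injOn
    (Sum.elim (fun p => ((p.1 : ℤ) + 1, p.2)) (fun p => (-p.2, -((p.1 : ℤ) + 1)))) ?_ ?_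
  · rintro (⟨j, b⟩ | ⟨j, b⟩) h <;>
    simp only [Finset.mem_coe, Finset.inl_mem_disjSum, Finset.inr_mem_disjSum,
      Finset.mem_sigma, Finset.mem_range, mem_leadInversions] at h <;>
    push_cast at h <;>
    simp only [Sum.elim_inl, Sum.elim_inr, Finset.mem_coe, mem_inversionPairs, hodd] <;>
    omega
  · rintro (⟨j, b⟩ | ⟨j, b⟩) h (⟨j', b'⟩ | ⟨j', b'⟩) h' e <;>
    simp only [Finset.mem_coe, Finset.inl_mem_disjSum, Finset.inr_mem_disjSum,
      Finset.mem_sigma, Finset.mem_range, mem_leadInversions] at h h' <;>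
    push_cast at h h' <;>
    simp only [Sum.elim_inl, Sum.elim_inr, Prod.mk.injEq] at e
    · obtain rfl : j = j' := by omega
      obtain rfl : b = b' := by omega
      rfl
    · omega
    · omega
    · obtain rfl : j = j' := by omega
      obtain rfl : b = b' := by omega
      rfl

section Descents

variable {J : Finset ℕ} {w : Equiv.Perm ℤ}

theorem apply_lt_of_range_subset (hodd : ∀ x, w (-x) = -w x)
    (hJ : ∀ j ∈ J, w (rootFst j) < w (rootSnd j)) :
    ∀ j, Finset.range (j + 2) ⊆ J → w ((j : ℤ) + 2) < w (-((j : ℤ) + 1))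
  | 0, h => by simpa [rootFst, rootSnd] using hJ 0 (h (by simp))
  | j + 1, h => by
      have ih := apply_lt_of_range_subset hodd hJ j
        ((Finset.range_subset_range.2 (by omega)).trans h)
      have h1 := hJ (j + 1) (h (by simp))
      have h2 := hJ (j + 2) (h (by simp))
      simp only [rootFst, rootSnd, Nat.succ_ne_zero, if_false] at h1 h2
      push_cast at h1 h2 ⊢
      rw [hodd] at ih ⊢
      have e1 : (j : ℤ) + 1 + 1 = j + 2 := by ring
      have e2 : (j : ℤ) + 1 + 2 = j + 3 := by ring
      have e3 : (j : ℤ) + 2 + 1 = j + 3 := by ring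
      rw [e1] at h1 ⊢
      rw [e3] at h2
      rw [e2]
      omega

theorem leadCount_le_card (hodd : ∀ x, w (-x) = -w x)
    (hJ : ∀ j ∈ J, w (rootFst j) < w (rootSnd j)) :
    ∀ j, leadCount J j ≤ (leadInversions w (j + 1)).card
  | 0 => Nat.zero_le _
  | 1 => by
      have h0 := hJ 0
      have h1 := hJ 1
      simp only [rootFst, rootSnd, if_true, one_ne_zero, if_false] at h0 h1
      push_cast at h0 h1
      have m0 : 0 ∈ J → (-1 : ℤ) ∈ leadInversions w (1 + 1) := fun h => by
        rw [mem_leadInversions]; simpa using h0 h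
      have m1 : 1 ∈ J → (1 : ℤ) ∈ leadInversions w (1 + 1) := fun h => by
        rw [mem_leadInversions]; simpa using h1 h
      have key : ((if 0 ∈ J then {-1} else ∅) ∪ (if 1 ∈ J then {1} else ∅) : Finset ℤ) ⊆
          leadInversions w (1 + 1) := by
        refine Finset.union_subset ?_ ?_ <;> split_ifs with h
        · simpa using m0 h
        · simp
        · simpa using m1 h
        · simp
      refine le_trans (le_of_eq ?_) (Finset.card_le_card key)
      rw [leadCount]
      split_ifs <;> rfl
  | j + 2 => by
      rw [leadCount]
      split_ifs with hj hfull
      · have ih := leadCount_le_card hodd hJ (j + 1)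
        have hd := hJ _ hj
        have hf := apply_lt_of_range_subset hodd hJ j hfull
        simp only [rootFst, rootSnd, Nat.succ_ne_zero, if_false] at hd
        push_cast at hd
        have hsub : insert ((j : ℤ) + 2) (insert (-((j : ℤ) + 2))
            (leadInversions w (j + 1 + 1))) ⊆ leadInversions w (j + 2 + 1) := by
          have hf' : w ((j : ℤ) + 2 + 1) < w (-((j : ℤ) + 2)) := by
            have h1 := hJ (j + 1) (hfull (by simp))
            simp only [rootFst, rootSnd, Nat.succ_ne_zero, if_false] at h1
            push_cast at h1
            rw [show (j : ℤ) + 1 + 1 = j + 2 by ring] at h1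
            rw [hodd] at hf ⊢
            omega
          intro b hb
          simp only [Finset.mem_insert, mem_leadInversions] at hb ⊢
          push_cast at hb ⊢
          rw [show (j : ℤ) + 1 + 1 = j + 2 by ring] at hb
          rcases hb with rfl | rfl | hb
          · omega
          · omega
          · omega
        have := Finset.card_le_card hsub
        rw [Finset.card_insert_of_notMem, Finset.card_insert_of_notMem] at this
        · omega
        · rw [mem_leadInversions]; push_cast; omega
        · rw [Finset.mem_insert, mem_leadInversions]; push_cast; omega
      · have ih := leadCount_le_card hodd hJ (j + 1)
        have hd := hJ _ hj
        simp only [rootFst, rootSnd, Nat.succ_ne_zero, if_false] at hd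
        push_cast at hd
        have hsub : insert ((j : ℤ) + 2) (leadInversions w (j + 1 + 1)) ⊆
            leadInversions w (j + 2 + 1) := by
          intro b hb
          simp only [Finset.mem_insert, mem_leadInversions] at hb ⊢
          push_cast at hb ⊢
          rw [show (j : ℤ) + 1 + 1 = j + 2 by ring] at hb
          rcases hb with rfl | hb
          · omega
          · omega
        have := Finset.card_le_card hsub
        rw [Finset.card_insert_of_notMem] at this
        · omega
        · rw [mem_leadInversions]; push_cast; omega
      · exact Nat.zero_le _

end Descents

end SignedPermutations

section LongestElement

theorem mul_pow_two_eq_one_iff {G : Type*} [Group G] {a b : G} (ha : a * a = 1)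
    (hb : b * b = 1) : (a * b) ^ 2 = 1 ↔ a * b = b * a := by
  have e : b * a = (a * b)⁻¹ := by
    rw [mul_inv_rev, inv_eq_of_mul_eq_one_left ha, inv_eq_of_mul_eq_one_left hb]
  rw [e, sq, mul_eq_one_iff_eq_inv]

theorem mul_pow_three_eq_one_iff {G : Type*} [Group G] {a b : G} (ha : a * a = 1)
    (hb : b * b = 1) : (a * b) ^ 3 = 1 ↔ a * b * a = b * a * b := by
  have e : b * a * b = (b * a * b)⁻¹ := by
    rw [mul_inv_rev, mul_inv_rev, inv_eq_of_mul_eq_one_left ha,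
      inv_eq_of_mul_eq_one_left hb, mul_assoc]
  have e' : (a * b) ^ 3 = a * b * a * (b * a * b) := by
    rw [pow_three]; group
  rw [e', mul_eq_one_iff_eq_inv, ← e]

variable {n : ℕ}

theorem Dmat_eq_three {i j : Fin n} (h : ForkAdj i.rev j.rev) : Dmat n i j = 3 := by
  have hij : i ≠ j := by
    rintro rfl
    unfold ForkAdj at h
    omega
  show (if i = j then 1 else if _ then 3 else 2) = 3
  unfold ForkAdj at h
  rw [if_neg hij, if_pos]
  simp only [Fin.val_rev] at h
  have := i.isLt
  have := j.isLt
  omega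

theorem Dmat_eq_two {i j : Fin n} (hij : (i.rev : ℕ) < j.rev) (h : ¬ ForkAdj i.rev j.rev) :
    Dmat n i j = 2 := by
  have hij' : i ≠ j := by
    rintro rfl
    omega
  show (if i = j then 1 else if _ then 3 else 2) = 2
  unfold ForkAdj at h
  rw [if_neg hij', if_neg]
  simp only [Fin.val_rev] at h hij
  have := i.isLt
  have := j.isLt
  omega

theorem isLiftable_signedSimple (n : ℕ) :
    (Dmat n).IsLiftable fun i => signedSimple (i.rev : ℕ) := by
  have key : ∀ i j : Fin n, (i.rev : ℕ) < j.rev →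
      (signedSimple (i.rev : ℕ) * signedSimple (j.rev : ℕ)) ^ Dmat n i j = 1 ∧
      (signedSimple (j.rev : ℕ) * signedSimple (i.rev : ℕ)) ^ Dmat n j i = 1 := by
    intro i j hij
    rw [(Dmat n).symmetric j i]
    by_cases h : ForkAdj i.rev j.rev
    · rw [Dmat_eq_three h, mul_pow_three_eq_one_iff (signedSimple_mul_self _)
        (signedSimple_mul_self _), mul_pow_three_eq_one_iff (signedSimple_mul_self _)
        (signedSimple_mul_self _)]
      exact ⟨signedSimple_braid h, (signedSimple_braid h).symm⟩
    · rw [Dmat_eq_two hij h, mul_pow_two_eq_one_iff (signedSimple_mul_self _)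
        (signedSimple_mul_self _), mul_pow_two_eq_one_iff (signedSimple_mul_self _)
        (signedSimple_mul_self _)]
      exact ⟨signedSimple_comm hij h, (signedSimple_comm hij h).symm⟩
  intro i j
  rcases lt_trichotomy (i.rev : ℕ) j.rev with h | h | h
  · exact (key i j h).1
  · obtain rfl : i = j := Fin.rev_injective (Fin.ext h)
    rw [(Dmat n).diagonal, pow_one, signedSimple_mul_self]
  · exact (key j i h).2

/-- The signed permutation representation of the Coxeter group of type `D`. -/
noncomputable def signedPerm (n : ℕ) : (Dmat n).Group →* Equiv.Perm ℤ :=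
  (Dmat n).toCoxeterSystem.lift ⟨_, isLiftable_signedSimple n⟩

theorem signedPerm_simple (i : Fin n) :
    signedPerm n ((Dmat n).toCoxeterSystem.simple i) = signedSimple (i.rev : ℕ) :=
  (Dmat n).toCoxeterSystem.lift_apply_simple (isLiftable_signedSimple n) i

theorem signedPerm_neg (g : (Dmat n).Group) (x : ℤ) :
    signedPerm n g (-x) = -signedPerm n g x := by
  induction g using (Dmat n).toCoxeterSystem.simple_induction_left with
  | one => simp
  | mul_simple_left g i ih =>
    rw [map_mul, signedPerm_simple, Equiv.Perm.mul_apply, Equiv.Perm.mul_apply, ih,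
      signedSimple_neg]

theorem card_inversionPairs_le (hn : 2 ≤ n) (g : (Dmat n).Group) :
    (inversionPairs n (signedPerm n g)).card ≤ 2 * (Dmat n).toCoxeterSystem.length g := by
  obtain ⟨ω, hω, rfl⟩ := (Dmat n).toCoxeterSystem.exists_isReduced g
  rw [hω.eq]
  clear hω
  induction ω using List.reverseRecOn with
  | nil =>
    rw [CoxeterSystem.wordProd_nil, map_one, List.length_nil, mul_zero, Nat.le_zero,
      Finset.card_eq_zero, Finset.eq_empty_iff_forall_notMem]
    rintro ⟨x, y⟩ h
    have := mem_inversionPairs.1 h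
    simp only [Equiv.Perm.one_apply] at this
    omega
  | append_singleton ω i ih =>
    rw [CoxeterSystem.wordProd_append, CoxeterSystem.wordProd_singleton, map_mul,
      signedPerm_simple, List.length_append, List.length_singleton]
    have := card_inversionPairs_mul_le hn (i.rev).isLt
      (signedPerm n ((Dmat n).toCoxeterSystem.wordProd ω))
    omega

/-- The nodes in `J`, numbered from the fork. -/
def forkNodes (J : Finset (Fin n)) : Finset ℕ := J.image fun i => (i.rev : ℕ)

/-- The simple reflections of type `D`, numbered from the fork. -/
noncomputable def forkSimple (n k : ℕ) : (Dmat n).Group :=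
  if h : k < n then (Dmat n).toCoxeterSystem.simple (Fin.rev ⟨k, h⟩) else 1

theorem forkSimple_rev (i : Fin n) :
    forkSimple n i.rev = (Dmat n).toCoxeterSystem.simple i := by
  rw [forkSimple, dif_pos i.rev.isLt, Fin.eta, Fin.rev_rev]

theorem forkRel_forkSimple (J : Finset (Fin n)) : ForkRel (forkSimple n) (forkNodes J) := by
  have sq (i : Fin n) := (Dmat n).toCoxeterSystem.simple_mul_simple_self i
  constructor
  · intro _ hi
    obtain ⟨i, -, rfl⟩ := Finset.mem_image.1 hi
    rw [forkSimple_rev, sq]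
  · intro _ hi _ hj hij h
    obtain ⟨i, -, rfl⟩ := Finset.mem_image.1 hi
    obtain ⟨j, -, rfl⟩ := Finset.mem_image.1 hj
    rw [forkSimple_rev, forkSimple_rev, ← mul_pow_two_eq_one_iff (sq i) (sq j),
      ← Dmat_eq_two hij h, CoxeterSystem.simple_mul_simple_pow]
  · intro _ hi _ hj hij h
    obtain ⟨i, -, rfl⟩ := Finset.mem_image.1 hi
    obtain ⟨j, -, rfl⟩ := Finset.mem_image.1 hj
    rw [forkSimple_rev, forkSimple_rev, ← mul_pow_three_eq_one_iff (sq i) (sq j),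
      ← Dmat_eq_three h, CoxeterSystem.simple_mul_simple_pow]

theorem parabolic_eq_initialParabolic (hn : 2 ≤ n) (J : Finset (Fin n)) :
    parabolic (Dmat n).toCoxeterSystem (J : Set (Fin n)) =
      initialParabolic (forkSimple n) (forkNodes J) (n - 1) := by
  unfold parabolic initialParabolic
  congr 1
  ext g
  simp only [Set.mem_image, Set.mem_ofPred_eq, Finset.mem_coe, forkNodes, Finset.mem_image]
  constructor
  · rintro ⟨i, hi, rfl⟩
    exact ⟨i.rev, ⟨⟨i, hi, rfl⟩, by omega, by omega⟩, forkSimple_rev i⟩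
  · rintro ⟨_, ⟨⟨i, hi, rfl⟩, -⟩, rfl⟩
    exact ⟨i, hi, (forkSimple_rev i).symm⟩

theorem length_le_of_mem_parabolic (hn : 2 ≤ n) (J : Finset (Fin n)) {g : (Dmat n).Group}
    (hg : g ∈ parabolic (Dmat n).toCoxeterSystem (J : Set (Fin n))) :
    (Dmat n).toCoxeterSystem.length g ≤ ∑ j ∈ Finset.range n, leadCount (forkNodes J) j := by
  rw [parabolic_eq_initialParabolic hn] at hg
  have h := (forkRel_forkSimple J).len_le (Dmat n).toCoxeterSystem.length_one
    (Dmat n).toCoxeterSystem.length_mul_le ?_ (n - 1) g hg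
  · rwa [Nat.sub_add_cancel (by omega)] at h
  · intro _ hi
    obtain ⟨i, -, rfl⟩ := Finset.mem_image.1 hi
    rw [forkSimple_rev, CoxeterSystem.length_simple]

theorem exists_mem_parabolic_le_length (hn : 2 ≤ n) (J : Finset (Fin n)) :
    ∃ g ∈ parabolic (Dmat n).toCoxeterSystem (J : Set (Fin n)),
      ∑ j ∈ Finset.range n, leadCount (forkNodes J) j ≤
        (Dmat n).toCoxeterSystem.length g := by
  set P := parabolic (Dmat n).toCoxeterSystem (J : Set (Fin n))
  set inv : (Dmat n).Group → ℕ := fun g => (inversionPairs n (signedPerm n g)).card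
  have hbdd : BddAbove (inv '' P) := by
    refine ⟨(Finset.Icc (-n : ℤ) n ×ˢ Finset.Icc (-n : ℤ) n).card, ?_⟩
    rintro _ ⟨g, -, rfl⟩
    exact Finset.card_le_card (Finset.filter_subset _ _)
  obtain ⟨g, hg, hmax⟩ := Nat.sSup_mem (s := inv '' P) ⟨_, 1, one_mem P, rfl⟩ hbdd
  refine ⟨g, hg, ?_⟩
  have hdesc : ∀ j ∈ forkNodes J,
      signedPerm n g (rootFst j) < signedPerm n g (rootSnd j) := by
    intro _ hj
    obtain ⟨i, hi, rfl⟩ := Finset.mem_image.1 hj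
    refine lt_of_le_of_ne (not_lt.1 fun h => ?_) fun h => ?_
    · have h1 := card_inversionPairs_lt_mul hn i.rev.isLt (signedPerm_neg g) h
      rw [← signedPerm_simple, ← map_mul] at h1
      have h2 : inv (g * (Dmat n).toCoxeterSystem.simple i) ≤ sSup (inv '' P) :=
        le_csSup hbdd ⟨_, mul_mem hg (Subgroup.subset_closure ⟨i, hi, rfl⟩), rfl⟩
      rw [← hmax] at h2
      exact absurd h1 (not_lt.2 h2)
    · have := (signedPerm n g).injective h
      unfold rootFst rootSnd at this
      split_ifs at this
      omega
  have h1 := two_mul_sum_card_leadInversions_le n (signedPerm_neg g)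
  have h2 := Finset.sum_le_sum fun j (_ : j ∈ Finset.range n) =>
    leadCount_le_card (signedPerm_neg g) hdesc j
  have h3 := card_inversionPairs_le hn g
  omega

theorem lenD_eq (hn : 2 ≤ n) (J : Finset (Fin n)) :
    lenD n J = ∑ j ∈ Finset.range n, leadCount (forkNodes J) j := by
  obtain ⟨g, hg, hle⟩ := exists_mem_parabolic_le_length hn J
  have hex : ∃ w ∈ parabolic (Dmat n).toCoxeterSystem (J : Set (Fin n)),
      ∀ u ∈ parabolic (Dmat n).toCoxeterSystem (J : Set (Fin n)),
        (Dmat n).toCoxeterSystem.length u ≤ (Dmat n).toCoxeterSystem.length w :=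
    ⟨g, hg, fun u hu => (length_le_of_mem_parabolic hn J hu).trans hle⟩
  unfold lenD w0
  rw [dif_pos hex]
  exact le_antisymm (length_le_of_mem_parabolic hn J hex.choose_spec.1)
    (hle.trans (hex.choose_spec.2 g hg))

end LongestElement

section GeneratingFunction

theorem leadCount_congr {J K : Finset ℕ} :
    ∀ j, (∀ i ≤ j, i ∈ J ↔ i ∈ K) → leadCount J j = leadCount K j
  | 0, _ => rfl
  | 1, h => by simp only [leadCount, h 0 (by omega), h 1 le_rfl]
  | j + 2, h => by
      have hsub : Finset.range (j + 2) ⊆ J ↔ Finset.range (j + 2) ⊆ K :=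
        forall₂_congr fun i hi => h i (Finset.mem_range.1 hi).le
      simp only [leadCount, h (j + 2) le_rfl, hsub,
        leadCount_congr (j + 1) fun i hi => h i (by omega)]

theorem sum_range_add_one_eq_choose (r : ℕ) :
    ∑ k ∈ Finset.range r, (k + 1) = (r + 1).choose 2 := by
  induction r with
  | zero => rfl
  | succ r ih =>
    rw [Finset.sum_range_succ, ih, Nat.choose_succ_succ' (r + 1) 1, Nat.choose_one_right,
      add_comm]

theorem leadCount_run {K : Finset ℕ} {n r : ℕ} (hn : 2 ≤ n) (hK : n ∉ K)
    (hrun : ∀ k < r, n + 1 + k ∈ K) : ∀ k < r, leadCount K (n + 1 + k) = k + 1 := by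
  obtain ⟨m, rfl⟩ := Nat.exists_eq_add_of_le' hn
  intro k
  induction k with
  | zero =>
    intro hk
    have h1 : m + 1 + 2 ∈ K := hrun 0 hk
    have h2 : ¬ Finset.range (m + 1 + 2) ⊆ K := fun h => hK (h (by simp))
    show leadCount K (m + 1 + 2) = 1
    rw [leadCount, if_pos h1, if_neg h2, leadCount, if_neg hK]
  | succ k ih =>
    intro hk
    have h1 : m + 2 + k + 2 ∈ K := by
      convert hrun (k + 1) hk using 1
      ring
    have h2 : ¬ Finset.range (m + 2 + k + 2) ⊆ K := fun h =>
      hK (h (Finset.mem_range.2 (by omega)))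
    have ih' := ih (by omega)
    rw [show m + 2 + 1 + (k + 1) = m + 2 + k + 2 by ring, leadCount, if_pos h1, if_neg h2,
      show m + 2 + k + 1 = m + 2 + 1 + k by ring, ih']

theorem sum_leadCount_union_Ico {J : Finset ℕ} {n : ℕ} (r : ℕ) (hn : 2 ≤ n)
    (hJ : J ⊆ Finset.range n) :
    ∑ j ∈ Finset.range (n + 1 + r), leadCount (J ∪ Finset.Ico (n + 1) (n + 1 + r)) j =
      ∑ j ∈ Finset.range n, leadCount J j + (r + 1).choose 2 := by
  have hnJ : n ∉ J := fun h => by simpa using hJ h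
  have hnK : n ∉ J ∪ Finset.Ico (n + 1) (n + 1 + r) := by simp [hnJ]
  rw [Finset.sum_range_add, Finset.sum_range_succ, ← sum_range_add_one_eq_choose]
  have e1 : leadCount (J ∪ Finset.Ico (n + 1) (n + 1 + r)) n = 0 := by
    obtain ⟨m, rfl⟩ := Nat.exists_eq_add_of_le' hn
    rw [leadCount, if_neg hnK]
  rw [e1, add_zero]
  congr 1
  · refine Finset.sum_congr rfl fun j hj => leadCount_congr j fun i hi => ?_
    have := Finset.mem_range.1 hj
    simp only [Finset.mem_union, Finset.mem_Ico]
    exact or_iff_left (by omega)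
  · refine Finset.sum_congr rfl fun k hk => leadCount_run hn hnK (fun k hk => ?_) k
      (Finset.mem_range.1 hk)
    simp only [Finset.mem_union, Finset.mem_Ico]
    omega

theorem leadCount_succ_of_not_full {K : Finset ℕ} {r c : ℕ} (h1 : leadCount K 1 = c)
    (hK : ¬ Finset.range 2 ⊆ K) (hrun : ∀ k < r, k + 2 ∈ K) :
    ∀ k < r + 1, leadCount K (k + 1) = k + c := by
  intro k
  induction k with
  | zero => simp [h1]
  | succ k ih =>
    intro hk
    rw [leadCount, if_pos (hrun k (by omega)), if_neg, ih (by omega)]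
    · ring
    · exact fun h => hK ((Finset.range_subset_range.2 (by omega)).trans h)

theorem sum_leadCount_of_not_full {K : Finset ℕ} {r c : ℕ} (h1 : leadCount K 1 = c)
    (hK : ¬ Finset.range 2 ⊆ K) (hrun : ∀ k < r, k + 2 ∈ K) :
    ∑ j ∈ Finset.range (2 + r), leadCount K j = ∑ k ∈ Finset.range (r + 1), (k + c) := by
  rw [show 2 + r = r + 1 + 1 by ring, Finset.sum_range_succ', leadCount, add_zero]
  exact Finset.sum_congr rfl fun k hk =>
    leadCount_succ_of_not_full h1 hK hrun k (Finset.mem_range.1 hk)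

theorem sum_leadCount_of_full {K : Finset ℕ} {r : ℕ} (hK : Finset.range (2 + r) ⊆ K) :
    ∑ j ∈ Finset.range (2 + r), leadCount K j = (2 + r) ^ 2 - (2 + r) := by
  have e : ∀ j ∈ Finset.range (2 + r), leadCount K j = j * 2 := by
    intro j hj
    cases j with
    | zero => rfl
    | succ j =>
      rw [leadCount_of_range_subset j ((Finset.range_subset_range.2
        (by have := Finset.mem_range.1 hj; omega)).trans hK), mul_comm]
  rw [Finset.sum_congr rfl e, ← Finset.sum_mul, Finset.sum_range_id_mul_two, Nat.mul_sub, sq,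
    mul_one]

/-- The monomial `y ^ |J| * z ^ ℓ(w0(J))`, the nodes being numbered from the fork. -/
noncomputable def nodeWeight (n : ℕ) (J : Finset ℕ) : Polynomial (Polynomial ℤ) :=
  yv ^ J.card * zv ^ ∑ j ∈ Finset.range n, leadCount J j

/-- The sum of the weights of the subsets of `{0, …, n + r - 1}` containing the last `r`
nodes. -/
noncomputable def runSum (n r : ℕ) : Polynomial (Polynomial ℤ) :=
  ∑ J ∈ (Finset.range n).powerset, nodeWeight (n + r) (J ∪ Finset.Ico n (n + r))

theorem card_union_Ico {J : Finset ℕ} {m n : ℕ} (r : ℕ) (hJ : J ⊆ Finset.range m)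
    (hmn : m ≤ n) : (J ∪ Finset.Ico n (n + r)).card = J.card + r := by
  rw [Finset.card_union_of_disjoint, Nat.card_Ico, Nat.add_sub_cancel_left]
  rw [Finset.disjoint_left]
  intro i hi hi'
  have := Finset.mem_range.1 (hJ hi)
  have := Finset.mem_Ico.1 hi'
  omega

theorem runSum_succ {n : ℕ} (r : ℕ) (hn : 2 ≤ n) :
    runSum (n + 1) r = runSum n 0 * (yv ^ r * zv ^ (r + 1).choose 2) + runSum n (r + 1) := by
  rw [runSum, Finset.range_add_one, Finset.sum_powerset_insert Finset.notMem_range_self]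
  refine congrArg₂ (· + ·) ?_ ?_
  · rw [runSum, Finset.sum_mul]
    refine Finset.sum_congr rfl fun J hJ => ?_
    have hJ' := Finset.mem_powerset.1 hJ
    rw [nodeWeight, nodeWeight, sum_leadCount_union_Ico r hn hJ',
      card_union_Ico r hJ' (Nat.le_succ n), add_zero, Finset.Ico_self, Finset.union_empty]
    ring
  · rw [runSum]
    refine Finset.sum_congr rfl fun J _ => ?_
    rw [show n + 1 + r = n + (r + 1) by ring]
    refine congrArg (nodeWeight _) (Finset.ext fun i => ?_)
    simp only [Finset.mem_union, Finset.mem_insert, Finset.mem_Ico]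
    grind

theorem runSum_two (r : ℕ) :
    runSum 2 r = yv ^ r * zv ^ (r + 1).choose 2 +
      2 * (yv ^ (r + 1) * zv ^ (r + 2).choose 2) +
      yv ^ (r + 2) * zv ^ ((r + 2) ^ 2 - (r + 2)) := by
  have hrun : ∀ J : Finset ℕ, ∀ k < r, k + 2 ∈ J ∪ Finset.Ico 2 (2 + r) := fun J k hk => by
    simp only [Finset.mem_union, Finset.mem_Ico]
    omega
  have hempty := sum_leadCount_of_not_full (r := r) (K := ∅ ∪ Finset.Ico 2 (2 + r)) (c := 0)
    (by simp [leadCount]) (fun h => by simpa using h (show 0 ∈ Finset.range 2 by simp))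
    (hrun _)
  have hzero := sum_leadCount_of_not_full (r := r) (K := {0} ∪ Finset.Ico 2 (2 + r)) (c := 1)
    (by simp [leadCount]) (fun h => by simpa using h (show 1 ∈ Finset.range 2 by simp))
    (hrun _)
  have hone := sum_leadCount_of_not_full (r := r) (K := {1} ∪ Finset.Ico 2 (2 + r)) (c := 1)
    (by simp [leadCount]) (fun h => by simpa using h (show 0 ∈ Finset.range 2 by simp))
    (hrun _)
  have hfull := sum_leadCount_of_full (r := r) (K := {0, 1} ∪ Finset.Ico 2 (2 + r))
    (fun i hi => by
      simp only [Finset.mem_range, Finset.mem_union, Finset.mem_insert, Finset.mem_singleton,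
        Finset.mem_Ico] at hi ⊢
      omega)
  have hsum : ∑ k ∈ Finset.range (r + 1), (k + 0) = (r + 1).choose 2 := by
    simp only [add_zero]
    rw [Finset.sum_range_succ', sum_range_add_one_eq_choose, add_zero]
  have hp : (Finset.range 2).powerset = {∅, {0}, {1}, {0, 1}} := by decide
  rw [hsum] at hempty
  rw [sum_range_add_one_eq_choose] at hzero hone
  rw [runSum, hp, Finset.sum_insert (by decide), Finset.sum_insert (by decide),
    Finset.sum_insert (by decide), Finset.sum_singleton]
  simp only [nodeWeight]
  rw [hempty, hzero, hone, hfull, card_union_Ico (m := 2) r (by simp) le_rfl,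
    card_union_Ico (m := 2) r (by decide) le_rfl, card_union_Ico (m := 2) r (by decide) le_rfl,
    card_union_Ico (m := 2) r (by decide) le_rfl, add_comm 2 r]
  simp only [Finset.card_empty, Finset.card_singleton, Finset.card_pair zero_ne_one]
  ring

theorem finsum_card_mul_pow {α R : Type*} [Fintype α] [CommSemiring R] (a b : α → ℕ)
    (y z : R) :
    ∑ᶠ (k : ℕ), ∑ᶠ (l : ℕ), (Nat.card {x : α // a x = k ∧ b x = l} : R) * y ^ k * z ^ l =
      ∑ x, y ^ a x * z ^ b x := by
  classical
  have hcard : ∀ k l : ℕ, (Nat.card {x : α // a x = k ∧ b x = l} : R) * y ^ k * z ^ l =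
      ∑ x, if l = b x then (if k = a x then y ^ k * z ^ l else 0) else 0 := by
    intro k l
    rw [Nat.card_eq_fintype_card, Fintype.card_subtype, Finset.natCast_card_filter, mul_assoc,
      Finset.sum_mul]
    refine Finset.sum_congr rfl fun x _ => ?_
    simp only [eq_comm (a := l), eq_comm (a := k)]
    by_cases h1 : a x = k <;> by_cases h2 : b x = l <;> simp [h1, h2]
  have inner : ∀ k : ℕ,
      (∑ᶠ (l : ℕ), (Nat.card {x : α // a x = k ∧ b x = l} : R) * y ^ k * z ^ l) =
      ∑ x, if k = a x then y ^ k * z ^ b x else 0 := by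
    intro k
    simp only [hcard]
    rw [finsum_sum_comm]
    · refine Finset.sum_congr rfl fun x _ => ?_
      rw [finsum_eq_single _ (b x) fun l hl => if_neg hl, if_pos rfl]
    · intro x _
      exact (Set.finite_singleton (b x)).subset fun l hl => by
        by_contra h
        exact hl (if_neg h)
  simp only [inner]
  rw [finsum_sum_comm]
  · refine Finset.sum_congr rfl fun x _ => ?_
    rw [finsum_eq_single _ (a x) fun l hl => if_neg hl, if_pos rfl]
  · intro x _
    exact (Set.finite_singleton (a x)).subset fun l hl => by
      by_contra h
      exact hl (if_neg h)

theorem coe_rev_injective (n : ℕ) : Function.Injective fun i : Fin n => (i.rev : ℕ) :=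
  Fin.val_injective.comp Fin.rev_injective

theorem card_forkNodes {n : ℕ} (J : Finset (Fin n)) : (forkNodes J).card = J.card :=
  Finset.card_image_of_injective J (coe_rev_injective n)

theorem sum_nodeWeight_forkNodes (n : ℕ) :
    ∑ J : Finset (Fin n), nodeWeight n (forkNodes J) = runSum n 0 := by
  rw [runSum, add_zero, Finset.Ico_self]
  refine Finset.sum_bij (fun J _ => forkNodes J) ?_ ?_ ?_ ?_
  · intro J _
    rw [Finset.mem_powerset]
    intro _ hi
    obtain ⟨i, -, rfl⟩ := Finset.mem_image.1 hi
    exact Finset.mem_range.2 i.rev.isLt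
  · intro J _ K _ h
    exact Finset.image_injective (coe_rev_injective n) h
  · intro K hK
    refine ⟨Finset.univ.filter fun i : Fin n => (i.rev : ℕ) ∈ K, Finset.mem_univ _, ?_⟩
    ext k
    simp only [forkNodes, Finset.mem_image, Finset.mem_filter, Finset.mem_univ, true_and]
    constructor
    · rintro ⟨i, hi, rfl⟩
      exact hi
    · intro hk
      have hkn := Finset.mem_range.1 (Finset.mem_powerset.1 hK hk)
      exact ⟨Fin.rev ⟨k, hkn⟩, by simpa using hk, by simp⟩
  · intro J _
    rw [Finset.union_empty]

theorem coeff_TD {n : ℕ} (hn : 2 ≤ n) : PowerSeries.coeff n TD = runSum n 0 := by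
  rw [TD, PowerSeries.coeff_mk, if_neg (by omega)]
  simp only [Dcount]
  rw [finsum_card_mul_pow, ← sum_nodeWeight_forkNodes]
  refine Finset.sum_congr rfl fun J _ => ?_
  rw [nodeWeight, lenD_eq hn, card_forkNodes]

theorem coeff_TD_of_lt {n : ℕ} (hn : n < 2) : PowerSeries.coeff n TD = 0 := by
  rw [TD, PowerSeries.coeff_mk, if_pos hn]

theorem runSum_add_two (m r : ℕ) :
    runSum (m + 2) r = ∑ i ∈ Finset.range (m + 2),
      PowerSeries.coeff i TD * PowerSeries.coeff (m + 1 + r - i) Pser + runSum 2 (m + r) := by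
  induction m generalizing r with
  | zero =>
    simp [Finset.sum_range_succ, coeff_TD_of_lt]
  | succ m ih =>
    rw [show m + 1 + 2 = m + 2 + 1 by ring, runSum_succ r (by omega), ih (r + 1),
      Finset.sum_range_succ _ (m + 2), coeff_TD (by omega),
      show m + 1 + 1 + r - (m + 2) = r by omega, show m + 1 + 1 + r = m + 1 + (r + 1) by ring,
      show m + 1 + r = m + (r + 1) by ring, Pser, PowerSeries.coeff_mk]
    ring

end GeneratingFunction

/-- `T_D(x,y,z) · (1 - x·P) = x²·P + 2x·(P - 1) + R`. -/
theorem TD_mul_one_sub_xP :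
    TD * (1 - PowerSeries.X * Pser) =
      PowerSeries.X ^ 2 * Pser + 2 * PowerSeries.X * (Pser - 1) + Rser := by
  ext1 n
  rw [mul_sub, mul_one, ← mul_assoc, mul_comm TD, mul_assoc, mul_assoc 2]
  simp only [map_sub, map_add]
  rw [show (2 : PowerSeries (Polynomial (Polynomial ℤ))) = PowerSeries.C 2 from
    (map_ofNat PowerSeries.C 2).symm, PowerSeries.coeff_C_mul]
  match n with
  | 0 => simp [coeff_TD_of_lt, Rser, sq, mul_assoc]
  | 1 =>
    rw [coeff_TD_of_lt one_lt_two, PowerSeries.coeff_succ_X_mul (n := 0),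
      PowerSeries.coeff_succ_X_mul (n := 0), sq, mul_assoc,
      PowerSeries.coeff_succ_X_mul (n := 0), PowerSeries.coeff_zero_X_mul, PowerSeries.coeff_mul,
      Finset.Nat.antidiagonal_zero, Finset.sum_singleton, coeff_TD_of_lt zero_lt_two]
    simp only [map_sub, Pser, Rser, PowerSeries.coeff_mk, PowerSeries.coeff_one]
    norm_num
  | m + 2 =>
    rw [PowerSeries.coeff_X_pow_mul, PowerSeries.coeff_succ_X_mul,
      PowerSeries.coeff_succ_X_mul, PowerSeries.coeff_mul,
      Finset.Nat.sum_antidiagonal_eq_sum_range_succ_mk, coeff_TD (by omega),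
      runSum_add_two m 0, runSum_two, map_sub, PowerSeries.coeff_one, if_neg (by omega)]
    simp only [Pser, Rser, PowerSeries.coeff_mk, add_zero]
    rw [if_neg (by omega)]
    ring

end CoxeterCharPoly
end

section
/- For n ≥ 1, let (B_n, S) be the Coxeter system with S = {s_1,…,s_n}, m(s_i,s_{i+1}) = 3 for 1 ≤ i ≤ n−2, m(s_{n−1},s_n) = 4 (when n ≥ 2), and m(s_i,s_j) = 2 for |i−j| ≥ 2; let χ̂_{B_n}(q) denote its modified characteristic polynomial under the left weak order, with χ̂_{B_0}(q) = 1. Then, as formal power series in x with coefficients polynomials in q, (Σ_{n≥0} χ̂_{B_n}(q) x^n) · (Σ_{n≥0} (−1)^n q^{C(n,2)} x^n) = Σ_{n≥0} (−1)^n q^{n²} x^n. -/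
open Polynomial

namespace CoxeterCharPoly

variable {B W : Type*} [Group W] {M : CoxeterMatrix B}

/-- The length of the longest element of the standard parabolic subgroup `W_J` of the
Coxeter group of type `Bₙ`. -/
noncomputable def lenB (n : ℕ) (J : Finset (Fin n)) : ℕ :=
  (CoxeterMatrix.Bₙ n).toCoxeterSystem.length
    (w0 (CoxeterMatrix.Bₙ n).toCoxeterSystem (↑J : Set (Fin n)))

/-- The modified characteristic polynomial `χ̂_{Bₙ}(q) = Σ_{J ⊆ S} (-1)^|J| q^(ℓ(w0(J)))`
of the Coxeter group of type `Bₙ` under the left weak order (so `χ̂_{B₀} = 1`). -/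
noncomputable def chiB (n : ℕ) : Polynomial ℤ :=
  ∑ J : Finset (Fin n), (-1 : Polynomial ℤ) ^ J.card * X ^ lenB n J

theorem Bₙ_apply (n : ℕ) (i j : Fin n) :
    CoxeterMatrix.Bₙ n i j = if i = j then 1 else
      if (i : ℕ) = n - 1 ∧ (j : ℕ) = n - 2 ∨ (j : ℕ) = n - 1 ∧ (i : ℕ) = n - 2 then 4 else
        if (j : ℕ) + 1 = i ∨ (i : ℕ) + 1 = j then 3 else 2 := rfl

/-- The action of the `i`-th simple reflection of type `Bₙ` on coordinate vectors: it negates the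
coordinate `i` if `i = n - 1`, and swaps the coordinates `i` and `i + 1` otherwise. -/
def signedSwap (n i : ℕ) (v : ℕ → ℤ) : ℕ → ℤ := fun k =>
  if i + 1 = n then (if k = i then -v k else v k)
  else if k = i then v (i + 1) else if k = i + 1 then v i else v k

theorem signedSwap_isLiftable (n : ℕ) :
    (CoxeterMatrix.Bₙ n).IsLiftable (G := Function.End (ℕ → ℤ))
      fun i : Fin n => signedSwap n i := by
  rintro ⟨i, hi⟩ ⟨j, hj⟩
  rw [Bₙ_apply]
  funext v k
  simp only [Fin.mk.injEq]
  split_ifs with h1 h2 h3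
  · subst h1
    change signedSwap n i (signedSwap n i v) k = v k
    grind [signedSwap]
  · change signedSwap n i (signedSwap n j (signedSwap n i (signedSwap n j
      (signedSwap n i (signedSwap n j (signedSwap n i (signedSwap n j v))))))) k = v k
    rcases h2 with h2 | h2
    · obtain rfl : i = j + 1 := by omega
      obtain rfl : n = j + 2 := by omega
      simp only [signedSwap]
      grind
    · obtain rfl : j = i + 1 := by omega
      obtain rfl : n = i + 2 := by omega
      simp only [signedSwap]
      grind
  · change signedSwap n i (signedSwap n j (signedSwap n i (signedSwap n j
      (signedSwap n i (signedSwap n j v))))) k = v k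
    rcases h3 with rfl | rfl
    · have h1 : ¬ (j + 1 + 1 = n) := by omega
      have h2 : ¬ (j + 1 = n) := by omega
      simp only [signedSwap, h1, h2]
      grind
    · have h1 : ¬ (i + 1 + 1 = n) := by omega
      have h2 : ¬ (i + 1 = n) := by omega
      simp only [signedSwap, h1, h2]
      grind
  · change signedSwap n i (signedSwap n j (signedSwap n i (signedSwap n j v))) k = v k
    simp only [signedSwap]
    grind

/-- The representation of the Coxeter group of type `Bₙ` by signed permutations. -/
noncomputable def signedRep (n : ℕ) :
    (CoxeterMatrix.Bₙ n).Group →* Function.End (ℕ → ℤ) :=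
  (CoxeterMatrix.Bₙ n).toCoxeterSystem.lift ⟨_, signedSwap_isLiftable n⟩

theorem signedRep_simple_mul (n : ℕ) (i : Fin n) (w : (CoxeterMatrix.Bₙ n).Group)
    (v : ℕ → ℤ) :
    signedRep n ((CoxeterMatrix.Bₙ n).toCoxeterSystem.simple i * w) v =
      signedSwap n i (signedRep n w v) := by
  rw [map_mul]
  exact congrFun ((CoxeterMatrix.Bₙ n).toCoxeterSystem.lift_apply_simple
    (signedSwap_isLiftable n) i) _

/-- The positive roots of type `Bₙ` that are negative on the coordinate vector `v`: the triple
`(false, i, j)` stands for `eᵢ - eⱼ`, and `(true, i, j)` stands for `eᵢ + eⱼ`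
(or `eᵢ` if `i = j`). -/
def negRoots (n : ℕ) (v : ℕ → ℤ) : Finset (Bool × ℕ × ℕ) :=
  {r ∈ Finset.univ ×ˢ Finset.range n ×ˢ Finset.range n |
    if r.1 then r.2.1 ≤ r.2.2 ∧ v r.2.1 + v r.2.2 < 0 else r.2.1 < r.2.2 ∧ v r.2.1 < v r.2.2}

/-- The `i`-th simple root of type `Bₙ`. -/
def simpleRoot (n i : ℕ) : Bool × ℕ × ℕ :=
  if i + 1 = n then (true, i, i) else (false, i, i + 1)

/-- The action of the `i`-th simple reflection on the positive roots other than the `i`-th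
simple root. -/
def rootSwap (n i : ℕ) (r : Bool × ℕ × ℕ) : Bool × ℕ × ℕ :=
  if i + 1 = n then (if r.2.2 = i ∧ r.2.1 ≠ i then (!r.1, r.2) else r)
  else if r.1 then
    (true, min (Equiv.swap i (i + 1) r.2.1) (Equiv.swap i (i + 1) r.2.2),
      max (Equiv.swap i (i + 1) r.2.1) (Equiv.swap i (i + 1) r.2.2))
  else (false, Equiv.swap i (i + 1) r.2.1, Equiv.swap i (i + 1) r.2.2)

theorem rootSwap_mem {n i : ℕ} (hi : i < n) {v : ℕ → ℤ} {r : Bool × ℕ × ℕ}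
    (hr : r ∈ (negRoots n v).erase (simpleRoot n i)) :
    rootSwap n i r ∈ (negRoots n (signedSwap n i v)).erase (simpleRoot n i) := by
  obtain ⟨b, j, k⟩ := r
  simp only [negRoots, simpleRoot, rootSwap, signedSwap, Finset.mem_erase, Finset.mem_filter,
    Finset.mem_product, Finset.mem_univ, Finset.mem_range, Equiv.swap_apply_def] at hr ⊢
  by_cases h : i + 1 = n
  · cases b <;> grind
  · cases b <;> simp only [h] at hr ⊢ <;> grind

theorem rootSwap_rootSwap {n i : ℕ} {v : ℕ → ℤ} {r : Bool × ℕ × ℕ} (hr : r ∈ negRoots n v) :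
    rootSwap n i (rootSwap n i r) = r := by
  obtain ⟨b, j, k⟩ := r
  simp only [negRoots, rootSwap, Finset.mem_filter,
    Finset.mem_product, Finset.mem_univ, Finset.mem_range, Equiv.swap_apply_def] at hr ⊢
  by_cases h : i + 1 = n
  · cases b <;> grind
  · cases b <;> simp only [h] at hr ⊢ <;> grind

theorem signedSwap_signedSwap (n i : ℕ) (v : ℕ → ℤ) :
    signedSwap n i (signedSwap n i v) = v := by
  funext k
  grind [signedSwap]

theorem card_negRoots_signedSwap_erase {n i : ℕ} (hi : i < n) (v : ℕ → ℤ) :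
    ((negRoots n (signedSwap n i v)).erase (simpleRoot n i)).card =
      ((negRoots n v).erase (simpleRoot n i)).card := by
  refine Finset.card_nbij' (rootSwap n i) (rootSwap n i) (fun r hr => ?_)
    (fun r hr => rootSwap_mem hi hr)
    (fun r hr => rootSwap_rootSwap (Finset.mem_of_mem_erase hr))
    (fun r hr => rootSwap_rootSwap (Finset.mem_of_mem_erase hr))
  simpa only [signedSwap_signedSwap, SetLike.mem_coe] using rootSwap_mem hi hr

theorem card_negRoots_signedSwap_le {n i : ℕ} (hi : i < n) (v : ℕ → ℤ) :
    (negRoots n (signedSwap n i v)).card ≤ (negRoots n v).card + 1 := by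
  have h := card_negRoots_signedSwap_erase hi v
  have h1 := Finset.pred_card_le_card_erase (s := negRoots n (signedSwap n i v))
    (a := simpleRoot n i)
  have h2 := Finset.card_erase_le (s := negRoots n v) (a := simpleRoot n i)
  omega

/-- The coordinate vector `(n, n - 1, …, 1)` in the interior of the dominant chamber. -/
def rho (n : ℕ) : ℕ → ℤ := fun k => n - k

theorem negRoots_rho (n : ℕ) : negRoots n (rho n) = ∅ := by
  ext ⟨b, j, k⟩
  cases b <;> simp [negRoots, rho] <;> omega

/-- No root of type `Bₙ` vanishes on the coordinate vector `v`. -/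
def IsRegular (n : ℕ) (v : ℕ → ℤ) : Prop :=
  (∀ i < n, v i ≠ 0) ∧ ∀ i < n, ∀ j < n, i ≠ j → v i ≠ v j ∧ v i ≠ -v j

theorem isRegular_rho (n : ℕ) : IsRegular n (rho n) := by
  simp only [IsRegular, rho]
  grind

theorem IsRegular.signedSwap {n i : ℕ} (hi : i < n) {v : ℕ → ℤ} (hv : IsRegular n v) :
    IsRegular n (signedSwap n i v) := by
  obtain ⟨h1, h2⟩ := hv
  simp only [IsRegular, CoxeterCharPoly.signedSwap]
  refine ⟨fun k hk => ?_, fun k hk l hl hkl => ?_⟩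
  · grind
  · have := h2 k hk l hl hkl
    grind

theorem card_negRoots_le_length (n : ℕ) (w : (CoxeterMatrix.Bₙ n).Group) :
    (negRoots n (signedRep n w (rho n))).card ≤
      (CoxeterMatrix.Bₙ n).toCoxeterSystem.length w := by
  obtain ⟨ω, hω, rfl⟩ := (CoxeterMatrix.Bₙ n).toCoxeterSystem.exists_isReduced w
  rw [hω.eq]
  clear hω
  induction ω with
  | nil =>
    rw [CoxeterSystem.wordProd_nil, map_one]
    change (negRoots n (rho n)).card ≤ 0
    rw [negRoots_rho, Finset.card_empty]
  | cons i ω ih =>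
    rw [CoxeterSystem.wordProd_cons, signedRep_simple_mul, List.length_cons]
    exact (card_negRoots_signedSwap_le i.2 _).trans (Nat.add_le_add_right ih 1)

theorem isRegular_signedRep (n : ℕ) (w : (CoxeterMatrix.Bₙ n).Group) :
    IsRegular n (signedRep n w (rho n)) := by
  induction w using (CoxeterMatrix.Bₙ n).toCoxeterSystem.simple_induction_left with
  | one =>
    rw [map_one]
    exact isRegular_rho n
  | mul_simple_left w i ih =>
    rw [signedRep_simple_mul]
    exact ih.signedSwap i.2

/-- An element of a standard parabolic subgroup that maximizes the number of inversions makes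
the corresponding simple roots negative. -/
theorem exists_mem_parabolic_forall_simpleRoot_mem (n : ℕ) (J : Set (Fin n)) :
    ∃ w ∈ parabolic (CoxeterMatrix.Bₙ n).toCoxeterSystem J,
      ∀ i ∈ J, simpleRoot n i ∈ negRoots n (signedRep n w (rho n)) := by
  set f : (CoxeterMatrix.Bₙ n).Group → ℕ := fun w => (negRoots n (signedRep n w (rho n))).card
  have hbdd : BddAbove (f '' parabolic (CoxeterMatrix.Bₙ n).toCoxeterSystem J) := by
    refine ⟨(Finset.univ ×ˢ Finset.range n ×ˢ Finset.range n : Finset (Bool × ℕ × ℕ)).card, ?_⟩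
    rintro _ ⟨w, -, rfl⟩
    exact Finset.card_filter_le _ _
  obtain ⟨w, hw, hmax⟩ := Nat.sSup_mem (Set.Nonempty.image f ⟨1, one_mem _⟩) hbdd
  refine ⟨w, hw, fun i hi => ?_⟩
  by_contra hneg
  have hle : f ((CoxeterMatrix.Bₙ n).toCoxeterSystem.simple i * w) ≤ f w := by
    rw [hmax]
    exact le_csSup hbdd ⟨_, mul_mem (Subgroup.subset_closure ⟨i, hi, rfl⟩) hw, rfl⟩
  simp only [f, signedRep_simple_mul] at hle
  have hreg := isRegular_signedRep n w
  set v := signedRep n w (rho n)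
  have hpos : simpleRoot n i ∈ negRoots n (signedSwap n i v) := by
    have := i.2
    obtain ⟨h1, h2⟩ := hreg
    have h3 := h1 i i.2
    have h4 := h2 i i.2 (i + 1)
    simp only [negRoots, simpleRoot, signedSwap, Finset.mem_filter,
      Finset.mem_product, Finset.mem_univ, Finset.mem_range] at hneg ⊢
    grind
  have hcard := card_negRoots_signedSwap_erase i.2 v
  rw [Finset.erase_eq_of_notMem hneg] at hcard
  have := Finset.card_erase_add_one hpos
  omega

theorem exists_ge_notMem (J : Finset ℕ) (a : ℕ) : ∃ m, a ≤ m ∧ m ∉ J := by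
  obtain ⟨m, hm⟩ := Infinite.exists_notMem_finset (J ∪ Finset.range a)
  rw [Finset.mem_union, Finset.mem_range, not_or, not_lt] at hm
  exact ⟨m, hm.2, hm.1⟩

/-- The least element of `[a, ∞)` that is not in `J`. -/
def firstOut (J : Finset ℕ) (a : ℕ) : ℕ :=
  Nat.find (exists_ge_notMem J a)

theorem firstOut_eq_iff {J : Finset ℕ} {a b : ℕ} :
    firstOut J a = b ↔ a ≤ b ∧ b ∉ J ∧ ∀ m, a ≤ m → m < b → m ∈ J := by
  rw [firstOut, Nat.find_eq_iff]
  grind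

theorem firstOut_le {J : Finset ℕ} {n a : ℕ} (hJ : J ⊆ Finset.range n) (ha : a ∈ J) :
    firstOut J a ≤ n := by
  obtain ⟨-, -, h⟩ := firstOut_eq_iff.1 (rfl : firstOut J a = _)
  have := Finset.mem_range.1 (hJ ha)
  by_contra! hlt
  exact absurd (hJ (h n this.le hlt)) Finset.notMem_range_self

/-- The number of positive roots of the parabolic subsystem `J` of type `Bₙ` whose leading simple
root is the `a`-th one. -/
def runWeight (n : ℕ) (J : Finset ℕ) (a : ℕ) : ℕ :=
  if firstOut J a = n then 2 * (n - a) - 1 else firstOut J a - a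

/-- The index `m` of the `m`-th letter of the word `… (n - 2) (n - 1) (n - 2) …`. -/
def zigzag (n m : ℕ) : ℕ := if m < n then m else 2 * n - 2 - m

section Coset

variable {G : Type*} [Group G] {n : ℕ} {s : ℕ → G}

/-- The minimal coset representatives of `W_{J ∩ (a, n)}` in `W_{J ∩ [a, n)}`. -/
def cosetRep (s : ℕ → G) (n a : ℕ) : ℕ → G
  | 0 => 1
  | k + 1 => cosetRep s n a k * s (zigzag n (a + k))

/-- The defining relations of type `Bₙ`. -/
structure IsTypeB (s : ℕ → G) (n : ℕ) : Prop where
  sq : ∀ i < n, s i * s i = 1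
  comm : ∀ i < n, ∀ j < n, i + 2 ≤ j → s i * s j = s j * s i
  braid : ∀ i, i + 2 < n → s i * s (i + 1) * s i = s (i + 1) * s i * s (i + 1)
  braid_four : ∀ i, i + 2 = n →
    s i * s (i + 1) * s i * s (i + 1) = s (i + 1) * s i * s (i + 1) * s i

theorem IsTypeB.cosetRep_mul_comm (hs : IsTypeB s n) {J : Finset ℕ} (hJ : J ⊆ Finset.range n)
    {a : ℕ} (k : ℕ) : a + k + a < 2 * n → (∀ m < k, zigzag n (a + m) ∈ J) → ∀ j ∈ J, a ≤ j →
      j ≠ zigzag n (a + k) → (k ≠ 0 → j ≠ zigzag n (a + k - 1)) →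
      ∃ j' ∈ J, a < j' ∧ cosetRep s n a k * s j = s j' * cosetRep s n a k := by
  induction k using Nat.strong_induction_on with
  | _ k ih =>
  intro hk hmem j hj haj hne hne'
  have hJn : ∀ i ∈ J, i < n := fun i hi => Finset.mem_range.1 (hJ hi)
  have hjn := hJn j hj
  match k with
  | 0 =>
    refine ⟨j, hj, ?_, by simp [cosetRep]⟩
    grind [zigzag]
  | k + 1 =>
    have hl := hmem k (by omega)
    have hln := hJn _ hl
    have hjl : j ≠ zigzag n (a + k) := hne' (by omega)
    by_cases hadj : j + 1 = zigzag n (a + k) ∨ zigzag n (a + k) + 1 = j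
    · obtain ⟨k, rfl⟩ : ∃ k', k = k' + 1 := Nat.exists_eq_succ_of_ne_zero (by grind [zigzag])
      have hj2 : j = zigzag n (a + k) := by grind [zigzag]
      set l := zigzag n (a + (k + 1)) with hl_def
      by_cases hbraid : j + 1 ≠ n
      · obtain ⟨l', hl', hal', h⟩ := ih k (by omega) (by omega) (fun m hm => hmem m (by omega))
          l hl (by grind [zigzag]) (by grind [zigzag]) (by grind [zigzag])
        refine ⟨l', hl', hal', ?_⟩
        have hb : s j * s l * s j = s l * s j * s l := by
          have : l + 1 ≠ n := by grind [zigzag]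
          rcases hadj with h1 | h1
          · rw [← h1]
            exact hs.braid j (by omega)
          · rw [← h1]
            exact (hs.braid l (by omega)).symm
        simp only [cosetRep]
        rw [← hj2, ← hl_def]
        calc _ = cosetRep s n a k * (s j * s l * s j) := by group
          _ = cosetRep s n a k * s l * (s j * s l) := by rw [hb]; group
          _ = _ := by rw [h]; group
      · push Not at hbraid
        obtain ⟨k, rfl⟩ : ∃ k', k = k' + 1 := Nat.exists_eq_succ_of_ne_zero (by grind [zigzag])
        obtain ⟨l', hl', hal', h⟩ := ih k (by omega) (by omega) (fun m hm => hmem m (by omega))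
          j hj haj (by grind [zigzag]) (by grind [zigzag])
        have hl3 : l = zigzag n (a + k) := by grind [zigzag]
        refine ⟨l', hl', hal', ?_⟩
        have hlj : l + 1 = j := by grind [zigzag]
        have hb := hs.braid_four l (by omega)
        rw [hlj] at hb
        simp only [cosetRep]
        rw [← hj2, ← hl3, ← hl_def]
        calc _ = cosetRep s n a k * (s l * s j * s l * s j) := by group
          _ = cosetRep s n a k * s j * (s l * s j * s l) := by rw [hb]; group
          _ = _ := by rw [h]; group
    · obtain ⟨j', hj', haj', h⟩ := ih k (by omega) (by omega) (fun m hm => hmem m (by omega))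
        j hj haj hjl (by grind [zigzag])
      refine ⟨j', hj', haj', ?_⟩
      have hc : s (zigzag n (a + k)) * s j = s j * s (zigzag n (a + k)) := by
        rcases lt_or_gt_of_ne hjl with h1 | h1
        · exact (hs.comm j hjn _ hln (by omega)).symm
        · exact hs.comm _ hln _ hjn (by omega)
      rw [cosetRep, mul_assoc, hc, ← mul_assoc, h, mul_assoc]

theorem zigzag_mem {J : Finset ℕ} (hJ : J ⊆ Finset.range n) {a k : ℕ}
    (hk : k < runWeight n J a) :
    zigzag n (a + k) ∈ J := by
  obtain ⟨h1, h2, h3⟩ := firstOut_eq_iff.1 (rfl : firstOut J a = _)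
  unfold runWeight at hk
  unfold zigzag
  split_ifs at hk ⊢ with h4 h5
  · exact h3 _ (by omega) (by omega)
  · exact h3 _ (by omega) (by omega)
  · exact h3 _ (by omega) (by omega)
  · have := Finset.mem_range.1 (hJ (h3 (a + k) (by omega) (by omega)))
    omega

theorem IsTypeB.exists_eq_mul_cosetRep (hs : IsTypeB s n) {J : Finset ℕ}
    (hJ : J ⊆ Finset.range n) {a : ℕ} (ha : a ∈ J) {u : G}
    (hu : u ∈ Subgroup.closure (s '' {i | i ∈ J ∧ a ≤ i})) :
    ∃ x ∈ Subgroup.closure (s '' {i | i ∈ J ∧ a + 1 ≤ i}), ∃ k ≤ runWeight n J a,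
      u = x * cosetRep s n a k := by
  have hJn : ∀ i ∈ J, i < n := fun i hi => Finset.mem_range.1 (hJ hi)
  have hinv : ∀ i ∈ J, (s i)⁻¹ = s i := fun i hi => inv_eq_of_mul_eq_one_left (hs.sq i (hJn i hi))
  have key : ∀ j ∈ J, a ≤ j → ∀ k ≤ runWeight n J a,
      ∃ x ∈ Subgroup.closure (s '' {i | i ∈ J ∧ a + 1 ≤ i}), ∃ k' ≤ runWeight n J a,
        cosetRep s n a k * s j = x * cosetRep s n a k' := by
    intro j hj haj k hk
    have hw : a + runWeight n J a + a < 2 * n := by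
      have := firstOut_le hJ ha
      have := hJn a ha
      have := firstOut_eq_iff.1 (rfl : firstOut J a = _)
      unfold runWeight
      split_ifs <;> omega
    by_cases h2 : k ≠ 0 ∧ j = zigzag n (a + k - 1)
    · obtain ⟨k, rfl⟩ := Nat.exists_eq_succ_of_ne_zero h2.1
      refine ⟨1, one_mem _, k, by omega, ?_⟩
      rw [one_mul, cosetRep, h2.2, mul_assoc]
      rw [show a + k.succ - 1 = a + k by omega, hs.sq _ (hJn _ (zigzag_mem hJ (by omega))), mul_one]
    by_cases h1 : j = zigzag n (a + k)
    · refine ⟨1, one_mem _, k + 1, ?_, by rw [one_mul, cosetRep, ← h1]⟩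
      by_contra! hlt
      obtain rfl : k = runWeight n J a := by omega
      have hf := firstOut_eq_iff.1 (rfl : firstOut J a = _)
      have := firstOut_le hJ ha
      unfold runWeight at h1 h2
      unfold zigzag at h1 h2
      split_ifs at h1 h2 <;> grind
    · obtain ⟨j', hj', haj', h⟩ := hs.cosetRep_mul_comm hJ k (by omega)
        (fun m hm => zigzag_mem hJ (hm.trans_le hk)) j hj haj h1 (fun h0 h => h2 ⟨h0, h⟩)
      exact ⟨s j', Subgroup.subset_closure ⟨j', ⟨hj', haj'⟩, rfl⟩, k, hk, h⟩
  have step : ∀ j ∈ J, a ≤ j → ∀ v, (∃ x ∈ Subgroup.closure (s '' {i | i ∈ J ∧ a + 1 ≤ i}),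
      ∃ k ≤ runWeight n J a, v = x * cosetRep s n a k) →
      ∃ x ∈ Subgroup.closure (s '' {i | i ∈ J ∧ a + 1 ≤ i}),
      ∃ k ≤ runWeight n J a, v * s j = x * cosetRep s n a k := by
    rintro j hj haj _ ⟨x, hx, k, hk, rfl⟩
    obtain ⟨y, hy, k', hk', h⟩ := key j hj haj k hk
    exact ⟨x * y, mul_mem hx hy, k', hk', by rw [mul_assoc, h, mul_assoc]⟩
  induction hu using Subgroup.closure_induction_right with
  | one => exact ⟨1, one_mem _, 0, Nat.zero_le _, by simp [cosetRep]⟩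
  | mul_right v _ y hy ih =>
    obtain ⟨j, ⟨hj, haj⟩, rfl⟩ := hy
    exact step j hj haj v ih
  | mul_inv_cancel v _ y hy ih =>
    obtain ⟨j, ⟨hj, haj⟩, rfl⟩ := hy
    rw [hinv j hj]
    exact step j hj haj v ih

end Coset

theorem length_cosetRep_le {n : ℕ} {s : ℕ → W} (cs : CoxeterSystem M W)
    (hs : ∀ i, cs.length (s i) ≤ 1) (a k : ℕ) : cs.length (cosetRep s n a k) ≤ k := by
  induction k with
  | zero => simp [cosetRep]
  | succ k ih => exact (cs.length_mul_le _ _).trans (add_le_add ih (hs _))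

theorem IsTypeB.length_le {n : ℕ} {s : ℕ → W} (hs : IsTypeB s n) (cs : CoxeterSystem M W)
    (hlen : ∀ i, cs.length (s i) ≤ 1) {J : Finset ℕ} (hJ : J ⊆ Finset.range n) {u : W}
    (hu : u ∈ Subgroup.closure (s '' J)) : cs.length u ≤ ∑ a ∈ J, runWeight n J a := by
  have key : ∀ d a, n ≤ a + d → ∀ u ∈ Subgroup.closure (s '' {i | i ∈ J ∧ a ≤ i}),
      cs.length u ≤ ∑ i ∈ J with a ≤ i, runWeight n J i := by
    intro d
    induction d with
    | zero =>
      intro a ha u hu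
      have hempty : {i | i ∈ J ∧ a ≤ i} = ∅ := by
        ext i
        have := @hJ i
        simp_all
        grind
      rw [hempty, Set.image_empty, Subgroup.closure_empty, Subgroup.mem_bot] at hu
      simp [hu]
    | succ d ih =>
      intro a ha u hu
      by_cases haJ : a ∈ J
      · obtain ⟨x, hx, k, hk, rfl⟩ := hs.exists_eq_mul_cosetRep hJ haJ hu
        have hsplit : {i ∈ J | a ≤ i} = insert a {i ∈ J | a + 1 ≤ i} := by
          ext i
          grind
        rw [hsplit, Finset.sum_insert (by simp), add_comm]
        exact (cs.length_mul_le _ _).trans (add_le_add (ih (a + 1) (by omega) x hx)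
          ((length_cosetRep_le cs hlen a k).trans hk))
      · have hstep : ∀ i, i ∈ J ∧ a ≤ i ↔ i ∈ J ∧ a + 1 ≤ i := by grind
        simp only [hstep] at hu
        rw [Finset.filter_congr (q := fun i => a + 1 ≤ i) fun i hi => by grind]
        exact ih (a + 1) (by omega) u hu
  simpa using key n 0 (by omega) u (by simpa using hu)

theorem eq_of_mul_pow_three {G : Type*} [Group G] {x y : G} (hx : x * x = 1) (hy : y * y = 1)
    (h : (x * y) ^ 3 = 1) : x * y * x = y * x * y := by
  have hx' : x⁻¹ = x := inv_eq_of_mul_eq_one_left hx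
  have hy' : y⁻¹ = y := inv_eq_of_mul_eq_one_left hy
  have : x * y * x = (y * x * y)⁻¹ := by
    apply eq_inv_of_mul_eq_one_left
    rw [← h]
    simp only [pow_succ, pow_zero, one_mul, mul_assoc]
  rw [this]
  simp only [mul_inv_rev, hx', hy', mul_assoc]

/-- The simple reflections of type `Bₙ`, indexed by the natural numbers. -/
noncomputable def simpleB (n i : ℕ) : (CoxeterMatrix.Bₙ n).Group :=
  if h : i < n then (CoxeterMatrix.Bₙ n).toCoxeterSystem.simple ⟨i, h⟩ else 1

theorem isTypeB_simpleB (n : ℕ) : IsTypeB (simpleB n) n := by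
  set cs := (CoxeterMatrix.Bₙ n).toCoxeterSystem with hcs
  have sq : ∀ i < n, simpleB n i * simpleB n i = 1 := fun i hi => by
    simp only [simpleB, hi, dite_true]
    exact cs.simple_mul_simple_self _
  have inv : ∀ i < n, (simpleB n i)⁻¹ = simpleB n i :=
    fun i hi => inv_eq_of_mul_eq_one_left (sq i hi)
  have pow : ∀ i (hi : i < n) j (hj : j < n),
      (simpleB n i * simpleB n j) ^ CoxeterMatrix.Bₙ n ⟨i, hi⟩ ⟨j, hj⟩ = 1 := by
    intro i hi j hj
    simp only [simpleB, hi, hj, dite_true]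
    exact cs.simple_mul_simple_pow _ _
  refine ⟨sq, fun i hi j hj hij => ?_, fun i hi => ?_, fun i hi => ?_⟩
  · have h := pow i hi j hj
    rw [Bₙ_apply, if_neg (by simp; omega), if_neg (by simp; omega), if_neg (by simp; omega),
      pow_two] at h
    rw [← inv_inv (simpleB n i * simpleB n j), inv_eq_of_mul_eq_one_left h, mul_inv_rev,
      inv i hi, inv j hj]
  · have h := pow i (by omega) (i + 1) (by omega)
    rw [Bₙ_apply, if_neg (by simp), if_neg (by simp; omega), if_pos (by simp)] at h
    exact eq_of_mul_pow_three (sq _ (by omega)) (sq _ (by omega)) h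
  · have h := pow i (by omega) (i + 1) (by omega)
    rw [Bₙ_apply, if_neg (by simp), if_pos (by simp; omega)] at h
    have h2 := inv_eq_of_mul_eq_one_left
      (a := simpleB n i * simpleB n (i + 1) * simpleB n i * simpleB n (i + 1))
      (b := simpleB n i * simpleB n (i + 1) * simpleB n i * simpleB n (i + 1))
      (by rw [← h]; simp only [pow_succ, pow_zero, one_mul, mul_assoc])
    rw [← h2]
    simp only [mul_inv_rev, inv i (by omega), inv (i + 1) (by omega), mul_assoc]

theorem length_simpleB_le (n i : ℕ) :
    (CoxeterMatrix.Bₙ n).toCoxeterSystem.length (simpleB n i) ≤ 1 := by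
  rw [simpleB]
  split_ifs with h
  · rw [← CoxeterSystem.wordProd_singleton]
    exact CoxeterSystem.length_wordProd_le _ _
  · simp

theorem simpleB_image (n : ℕ) (J : Finset (Fin n)) :
    simpleB n '' (J.map Fin.valEmbedding : Finset ℕ) =
      (CoxeterMatrix.Bₙ n).toCoxeterSystem.simple '' J := by
  rw [Finset.coe_map, Set.image_image]
  refine Set.image_congr fun i _ => ?_
  simp [simpleB]

theorem runWeight_le_card {n : ℕ} {J : Finset ℕ} (hJ : J ⊆ Finset.range n) {v : ℕ → ℤ}
    (hv : ∀ i ∈ J, simpleRoot n i ∈ negRoots n v) {a : ℕ} (ha : a ∈ J) :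
    runWeight n J a ≤ {r ∈ negRoots n v | r.2.1 = a}.card := by
  have hlt : ∀ i ∈ J, i + 1 < n → v i < v (i + 1) := by
    intro i hi hin
    have := hv i hi
    simp only [simpleRoot, negRoots] at this
    grind
  have han : a < n := Finset.mem_range.1 (hJ ha)
  obtain ⟨h1, h2, h3⟩ := firstOut_eq_iff.1 (rfl : firstOut J a = _)
  have hbn := firstOut_le hJ ha
  set b := firstOut J a with hb
  have hmono : ∀ i, a ≤ i → ∀ j, i + 1 ≤ j → j ≤ b → j < n → v i < v j := by
    intro i hi j hij
    induction j, hij using Nat.le_induction with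
    | base => exact fun hb hn => hlt i (h3 i hi (by omega)) hn
    | succ j hij ih =>
      exact fun hb hn => (ih (by omega) (by omega)).trans (hlt j (h3 j (by omega) (by omega)) hn)
  have hneg : b = n → ∀ j, a ≤ j → j < n → v j < 0 := by
    intro hbn j haj hj
    have h0 : v (n - 1) < 0 := by
      have := hv (n - 1) (h3 _ (by omega) (by omega))
      simp only [simpleRoot, negRoots] at this
      grind
    rcases Nat.lt_or_ge (j + 1) n with h | h
    · exact (hmono j haj (n - 1) (by omega) (by omega) (by omega)).trans h0
    · rwa [show j = n - 1 by omega]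
  have hinj : ∀ c : Bool, Function.Injective fun j : ℕ => (c, a, j) := fun c i j h => by
    simpa using h
  rw [runWeight, ← hb]
  split_ifs with h
  · have hdisj : Disjoint ((Finset.Ioo a n).map ⟨_, hinj false⟩)
        ((Finset.Ico a n).map ⟨_, hinj true⟩) := by
      rw [Finset.disjoint_left]
      simp
    calc 2 * (n - a) - 1 = (((Finset.Ioo a n).map ⟨_, hinj false⟩).disjUnion _ hdisj).card := by
          rw [Finset.card_disjUnion, Finset.card_map, Finset.card_map, Nat.card_Ioo, Nat.card_Ico]
          omega
      _ ≤ _ := by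
        refine Finset.card_le_card fun r hr => ?_
        rw [Finset.mem_disjUnion, Finset.mem_map, Finset.mem_map] at hr
        rcases hr with ⟨j, hj, rfl⟩ | ⟨j, hj, rfl⟩
        · rw [Finset.mem_Ioo] at hj
          have := hmono a le_rfl j hj.1 (by omega) hj.2
          simp [negRoots, *]
        · rw [Finset.mem_Ico] at hj
          have := hneg h j hj.1 hj.2
          have := hneg h a le_rfl han
          simp [negRoots, *]
          omega
  · calc b - a = ((Finset.Ioc a b).map ⟨_, hinj false⟩).card := by
          rw [Finset.card_map, Nat.card_Ioc]
      _ ≤ _ := by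
        refine Finset.card_le_card fun r hr => ?_
        rw [Finset.mem_map] at hr
        obtain ⟨j, hj, rfl⟩ := hr
        rw [Finset.mem_Ioc] at hj
        have := hmono a le_rfl j hj.1 hj.2 (by omega)
        have : j < n := by omega
        simp [negRoots, *]

theorem sum_runWeight_le_card {n : ℕ} {J : Finset ℕ} (hJ : J ⊆ Finset.range n) {v : ℕ → ℤ}
    (hv : ∀ i ∈ J, simpleRoot n i ∈ negRoots n v) :
    ∑ a ∈ J, runWeight n J a ≤ (negRoots n v).card :=
  (Finset.sum_le_sum fun _ ha => runWeight_le_card hJ hv ha).trans <| by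
    rw [Finset.sum_card_fiberwise_eq_card_filter]
    exact Finset.card_filter_le _ _

theorem lenB_eq (n : ℕ) (J : Finset (Fin n)) :
    lenB n J = ∑ a ∈ J.map Fin.valEmbedding, runWeight n (J.map Fin.valEmbedding) a := by
  have hJ : J.map Fin.valEmbedding ⊆ Finset.range n := fun i hi => by
    obtain ⟨j, -, rfl⟩ := Finset.mem_map.1 hi
    simp
  set cs := (CoxeterMatrix.Bₙ n).toCoxeterSystem
  have hle : ∀ u ∈ parabolic cs (J : Set (Fin n)),
      cs.length u ≤ ∑ a ∈ J.map Fin.valEmbedding, runWeight n (J.map Fin.valEmbedding) a := by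
    intro u hu
    rw [parabolic, ← simpleB_image] at hu
    exact (isTypeB_simpleB n).length_le cs (length_simpleB_le n) hJ hu
  obtain ⟨w, hw, hneg⟩ := exists_mem_parabolic_forall_simpleRoot_mem n (J : Set (Fin n))
  have hge : ∑ a ∈ J.map Fin.valEmbedding, runWeight n (J.map Fin.valEmbedding) a ≤
      cs.length w := by
    refine (sum_runWeight_le_card hJ fun i hi => ?_).trans (card_negRoots_le_length n w)
    obtain ⟨j, hj, rfl⟩ := Finset.mem_map.1 hi
    exact hneg j hj
  have hex : ∃ w ∈ parabolic cs (J : Set (Fin n)),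
      ∀ u ∈ parabolic cs (J : Set (Fin n)), cs.length u ≤ cs.length w :=
    ⟨w, hw, fun u hu => (hle u hu).trans hge⟩
  rw [lenB, w0, dif_pos hex]
  exact (hle _ hex.choose_spec.1).antisymm (hge.trans (hex.choose_spec.2 w hw))

theorem chiB_eq_sum_powerset (n : ℕ) :
    chiB n = ∑ J ∈ (Finset.range n).powerset,
      (-1 : Polynomial ℤ) ^ J.card * X ^ ∑ a ∈ J, runWeight n J a := by
  refine Finset.sum_bij (fun J _ => J.map Fin.valEmbedding) (fun J _ => ?_)
    (fun J _ K _ h => Finset.map_injective _ h) (fun J hJ => ?_) (fun J _ => ?_)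
  · rw [Finset.mem_powerset]
    intro i hi
    obtain ⟨j, -, rfl⟩ := Finset.mem_map.1 hi
    simp
  · have hJ' : ∀ i ∈ J, i < n := fun i hi => Finset.mem_range.1 (Finset.mem_powerset.1 hJ hi)
    exact ⟨J.attachFin hJ', Finset.mem_univ _, Finset.map_valEmbedding_attachFin hJ'⟩
  · rw [lenB_eq, Finset.card_map]

/-- The subset of `ℕ` that starts with `[0, m)`, omits `m`, and continues with the translate
of `J` by `m + 1`. -/
def prependRun (m : ℕ) (J : Finset ℕ) : Finset ℕ :=
  (Finset.range m).disjUnion (J.map (addRightEmbedding (m + 1))) <| by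
    rw [Finset.disjoint_left]
    simp
    omega

theorem mem_prependRun {m i : ℕ} {J : Finset ℕ} :
    i ∈ prependRun m J ↔ i < m ∨ m < i ∧ i - (m + 1) ∈ J := by
  rw [prependRun, Finset.mem_disjUnion, Finset.mem_range, Finset.mem_map]
  refine or_congr_right ⟨?_, fun h => ⟨_, h.2, by simp; omega⟩⟩
  rintro ⟨j, hj, rfl⟩
  simpa [Nat.lt_succ_iff] using ⟨by omega, hj⟩

theorem firstOut_prependRun {m : ℕ} (J : Finset ℕ) {a : ℕ} (ha : a ≤ m) :
    firstOut (prependRun m J) a = m := by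
  rw [firstOut_eq_iff]
  simp only [mem_prependRun]
  grind

theorem firstOut_prependRun_add (m : ℕ) (J : Finset ℕ) (a : ℕ) :
    firstOut (prependRun m J) (a + (m + 1)) = firstOut J a + (m + 1) := by
  obtain ⟨h1, h2, h3⟩ := firstOut_eq_iff.1 (rfl : firstOut J a = _)
  rw [firstOut_eq_iff]
  simp only [mem_prependRun]
  refine ⟨by omega, ?_, fun i hi hi' => Or.inr ⟨by omega, h3 _ (by omega) (by omega)⟩⟩
  rw [Nat.add_sub_cancel]
  rintro (h | h)
  · omega
  · exact h2 h.2

theorem sum_range_sub_eq_choose (m : ℕ) : ∑ a ∈ Finset.range m, (m - a) = (m + 1).choose 2 := by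
  rw [Nat.choose_two_right, ← Finset.sum_range_id, Finset.sum_range_succ',
    ← Finset.sum_range_reflect]
  simp only [add_zero]
  exact Finset.sum_congr rfl fun a ha => by have := Finset.mem_range.1 ha; omega

theorem sum_runWeight_prependRun {n m : ℕ} (hm : m < n) (J : Finset ℕ) :
    ∑ a ∈ prependRun m J, runWeight n (prependRun m J) a =
      (m + 1).choose 2 + ∑ a ∈ J, runWeight (n - 1 - m) J a := by
  conv_lhs => rw [prependRun]
  rw [Finset.sum_disjUnion, Finset.sum_map, ← sum_range_sub_eq_choose]
  refine congr_arg₂ _ (Finset.sum_congr rfl fun a ha => ?_) (Finset.sum_congr rfl fun a _ => ?_)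
  · have := firstOut_prependRun J (Finset.mem_range.1 ha).le
    rw [← prependRun, runWeight, this, if_neg hm.ne]
  · have := firstOut_prependRun_add m J a
    rw [← prependRun, addRightEmbedding_apply, runWeight, runWeight, this]
    split_ifs <;> omega

theorem sum_runWeight_range (n : ℕ) :
    ∑ a ∈ Finset.range n, runWeight n (Finset.range n) a = n ^ 2 := by
  have h : ∀ a ∈ Finset.range n, runWeight n (Finset.range n) a = 2 * (n - 1 - a) + 1 := by
    intro a ha
    rw [Finset.mem_range] at ha
    rw [runWeight, if_pos (firstOut_eq_iff.2 ⟨ha.le, by simp, by simp⟩)]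
    omega
  rw [Finset.sum_congr rfl h, Finset.sum_range_reflect (fun a => 2 * a + 1)]
  clear h
  induction n with
  | zero => rfl
  | succ n ih =>
    rw [Finset.sum_range_succ, ih]
    ring

theorem chiB_recurrence (n : ℕ) :
    chiB n = (-1) ^ n * X ^ (n ^ 2) +
      ∑ m ∈ Finset.range n, (-1) ^ m * X ^ (m + 1).choose 2 * chiB (n - 1 - m) := by
  have hmaps : ∀ J ∈ (Finset.range n).powerset, firstOut J 0 ∈ Finset.range (n + 1) := by
    intro J hJ
    rw [Finset.mem_powerset] at hJ
    by_cases h : 0 ∈ J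
    · exact Finset.mem_range_succ_iff.2 (firstOut_le hJ h)
    · rw [firstOut_eq_iff.2 ⟨le_rfl, h, by simp⟩]
      simp
  rw [chiB_eq_sum_powerset, ← Finset.sum_fiberwise_of_maps_to hmaps, Finset.sum_range_succ,
    add_comm]
  congr 1
  · have : {J ∈ (Finset.range n).powerset | firstOut J 0 = n} = {Finset.range n} := by
      ext J
      rw [Finset.mem_filter, Finset.mem_powerset, Finset.mem_singleton, firstOut_eq_iff]
      constructor
      · rintro ⟨h1, -, -, h2⟩
        exact h1.antisymm fun i hi => h2 i (Nat.zero_le i) (Finset.mem_range.1 hi)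
      · rintro rfl
        simp
    rw [this, Finset.sum_singleton, Finset.card_range, sum_runWeight_range]
  · refine Finset.sum_congr rfl fun m hm => ?_
    rw [Finset.mem_range] at hm
    rw [chiB_eq_sum_powerset, Finset.mul_sum]
    symm
    refine Finset.sum_bij (fun J _ => prependRun m J) (fun J hJ => ?_) (fun J _ K _ h => ?_)
      (fun J hJ => ?_) (fun J _ => ?_)
    · rw [Finset.mem_filter, Finset.mem_powerset]
      refine ⟨fun i hi => ?_, firstOut_prependRun J (Nat.zero_le m)⟩
      rw [mem_prependRun] at hi
      have hJ' := Finset.mem_powerset.1 hJ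
      have h1 := @hJ' (i - (m + 1))
      simp only [Finset.mem_range] at h1 ⊢
      grind
    · exact Finset.map_injective _ ((Finset.disjUnion_inj_right _ _).1 h)
    · rw [Finset.mem_filter, Finset.mem_powerset, firstOut_eq_iff] at hJ
      obtain ⟨hJn, -, h1, h2⟩ := hJ
      refine ⟨(Finset.range (n - 1 - m)).filter fun i => i + (m + 1) ∈ J, by simp, ?_⟩
      ext i
      have h3 := @hJn i
      have h4 := h2 i (Nat.zero_le i)
      rw [mem_prependRun, Finset.mem_filter]
      simp only [Finset.mem_range] at h3 ⊢
      grind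
    · have hcard : (prependRun m J).card = m + J.card := by
        rw [prependRun, Finset.card_disjUnion, Finset.card_range, Finset.card_map]
      rw [hcard, sum_runWeight_prependRun hm, pow_add, pow_add]
      ring

/-- `(Σ_{n≥0} χ̂_{Bₙ}(q) xⁿ) · (Σ_{n≥0} (-1)ⁿ q^(C(n,2)) xⁿ) = Σ_{n≥0} (-1)ⁿ q^(n²) xⁿ`. -/
theorem genfun_chiB :
    (PowerSeries.mk fun n => chiB n) *
        (PowerSeries.mk fun n => (-1 : Polynomial ℤ) ^ n * X ^ n.choose 2) =
      PowerSeries.mk fun n => (-1 : Polynomial ℤ) ^ n * X ^ (n ^ 2) := by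
  ext1 n
  rw [mul_comm, PowerSeries.coeff_mul]
  simp only [PowerSeries.coeff_mk]
  rw [Finset.Nat.sum_antidiagonal_eq_sum_range_succ
    (fun i j => (-1 : Polynomial ℤ) ^ i * X ^ i.choose 2 * chiB j), Finset.sum_range_succ',
    Nat.sub_zero, chiB_recurrence n]
  simp only [pow_zero, Nat.choose_zero_succ, one_mul]
  rw [add_left_comm, ← Finset.sum_add_distrib, Finset.sum_eq_zero, add_zero]
  intro m _
  rw [pow_succ, show n - (m + 1) = n - 1 - m by omega]
  ring

end CoxeterCharPoly
end

section
/- For n ≥ 2, let (Ã_n, S) be the affine Coxeter system with S = {s_1,…,s_{n+1}}, where m(s_i,s_j) = 3 if the indices i, j are adjacent in the cycle 1−2−⋯−(n+1)−1 (i.e., |i−j| = 1 or {i,j} = {1, n+1}) and m(s_i,s_j) = 2 otherwise. Then every proper parabolic subgroup of Ã_n is finite, χ̂_{Ã_n}(q) is a polynomial, and χ̂_{Ã_n}(q) = χ̂_{A_n}(q) + Σ_{k=1}^{n} k·(−1)^k q^{C(k+1,2)} χ̂_{A_{n−k−1}}(q), where χ̂_{A_m}(q) is the modified characteristic polynomial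 of the finite Coxeter group of type A_m and χ̂_{A_i}(q) = 1 for i ≤ 0. -/
open Polynomial

namespace CoxeterCharPoly

variable {B W : Type*} [Group W] {M : CoxeterMatrix B}

/-- The Coxeter matrix of affine type `Ãₙ`: `n + 1` generators arranged in a cycle,
with `m = 3` between adjacent generators and `m = 2` otherwise. -/
def tAmat (n : ℕ) : CoxeterMatrix (Fin (n + 1)) where
  M := Matrix.of fun i j =>
    if i = j then 1
    else if (min (i : ℕ) (j : ℕ) + 1 = max (i : ℕ) (j : ℕ))
        ∨ (min (i : ℕ) (j : ℕ) = 0 ∧ max (i : ℕ) (j : ℕ) = n) then 3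
    else 2
  isSymm := by
    ext i j
    simp only [Matrix.transpose_apply, Matrix.of_apply]
    by_cases h : i = j
    · subst h; rfl
    · rw [if_neg (Ne.symm h), if_neg h, min_comm, max_comm]
  diagonal := by intro i; simp
  off_diagonal := by
    intro i j h
    simp only [Matrix.of_apply, if_neg h]
    split <;> simp

/-- The length of the longest element of the standard parabolic subgroup `W_J` of the
Coxeter group of type `Aₙ`. -/
noncomputable def lenA (n : ℕ) (J : Finset (Fin n)) : ℕ :=
  (CoxeterMatrix.Aₙ n).toCoxeterSystem.length
    (w0 (CoxeterMatrix.Aₙ n).toCoxeterSystem (↑J : Set (Fin n)))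

/-- The modified characteristic polynomial `χ̂_{Aₙ}(q) = Σ_{J ⊆ S} (-1)^|J| q^(ℓ(w0(J)))`
of the finite Coxeter group of type `Aₙ` (so `χ̂_{A₀} = 1`). -/
noncomputable def chiA (n : ℕ) : Polynomial ℤ :=
  ∑ J : Finset (Fin n), (-1 : Polynomial ℤ) ^ J.card * X ^ lenA n J

/-- The modified characteristic polynomial of the affine Coxeter group `Ãₙ`:
`χ̂(q) = Σ_{J ⊆ S, W_J finite} (-1)^|J| q^(ℓ(w0(J)))`. -/
noncomputable def chiAffA (n : ℕ) : Polynomial ℤ :=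
  ∑ᶠ J ∈ {J : Finset (Fin (n + 1)) |
      ((parabolic (tAmat n).toCoxeterSystem (↑J : Set (Fin (n + 1)))) :
        Set (tAmat n).Group).Finite},
    (-1 : Polynomial ℤ) ^ J.card *
      X ^ (tAmat n).toCoxeterSystem.length (w0 (tAmat n).toCoxeterSystem (↑J : Set (Fin (n + 1))))

section AbsSum

variable {P : Type*} [Fintype P]

/-- The sum of the absolute values of the entries of a matrix. -/
def absSum (A : P → P → ℤ) : ℤ := ∑ x, ∑ y, |A x y|

lemma absSum_comp_perm (σ : Equiv.Perm P) (A : P → P → ℤ) :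
    absSum (fun x y => A (σ x) (σ y)) = absSum A := by
  rw [absSum, absSum, ← Equiv.sum_comp σ fun x => ∑ y, |A x y|]
  exact Finset.sum_congr rfl fun x _ => Equiv.sum_comp σ fun y => |A (σ x) y|

end AbsSum

section Shift

variable {P : Type*} [DecidableEq P]

/-- The antisymmetric matrix with entries `1` at `(a, b)` and `-1` at `(b, a)`. -/
def antisymmUnit (a b x y : P) : ℤ :=
  (if x = a ∧ y = b then 1 else 0) - (if x = b ∧ y = a then 1 else 0)

/-- Conjugation by the transposition of `a` and `b`, followed by adding `antisymmUnit a b`. -/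
def swapShift (a b : P) : Function.End (P → P → ℤ) := fun A x y =>
  A (Equiv.swap a b x) (Equiv.swap a b y) + antisymmUnit a b x y

lemma swapShift_mul_self (a b : P) : swapShift a b * swapShift a b = 1 := by
  funext A x y
  have : antisymmUnit a b (Equiv.swap a b x) (Equiv.swap a b y) + antisymmUnit a b x y = 0 := by
    simp only [antisymmUnit, Equiv.swap_apply_eq_iff, Equiv.swap_apply_left,
      Equiv.swap_apply_right]
    ring
  change A _ _ + _ + _ = A x y
  rw [Equiv.swap_apply_self, Equiv.swap_apply_self]
  linarith

lemma antisymmUnit_swap_of_disjoint {a b c d : P} (hac : a ≠ c) (had : a ≠ d) (hbc : b ≠ c)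
    (hbd : b ≠ d) (x y : P) :
    antisymmUnit c d (Equiv.swap a b x) (Equiv.swap a b y) = antisymmUnit c d x y := by
  have key : ∀ x e, a ≠ e → b ≠ e → (Equiv.swap a b x = e ↔ x = e) := by
    intro x e ha hb
    rw [Equiv.swap_apply_eq_iff, Equiv.swap_apply_of_ne_of_ne ha.symm hb.symm]
  simp only [antisymmUnit, key _ _ hac hbc, key _ _ had hbd]

lemma swapShift_commute {a b c d : P} (hac : a ≠ c) (had : a ≠ d) (hbc : b ≠ c) (hbd : b ≠ d) :
    swapShift a b * swapShift c d = swapShift c d * swapShift a b := by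
  funext A x y
  have hs : ∀ x, Equiv.swap a b (Equiv.swap c d x) = Equiv.swap c d (Equiv.swap a b x) := by
    intro x
    simp only [Equiv.swap_apply_def]
    grind
  change A _ _ + antisymmUnit c d (Equiv.swap a b x) (Equiv.swap a b y) + antisymmUnit a b x y =
    A _ _ + antisymmUnit a b (Equiv.swap c d x) (Equiv.swap c d y) + antisymmUnit c d x y
  rw [antisymmUnit_swap_of_disjoint hac had hbc hbd,
    antisymmUnit_swap_of_disjoint hac.symm hbc.symm had.symm hbd.symm, hs, hs]
  ring

lemma swapShift_braid {a b c : P} (hab : a ≠ b) (hbc : b ≠ c) (hac : a ≠ c) :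
    swapShift a b * swapShift b c * swapShift a b =
      swapShift b c * swapShift a b * swapShift b c := by
  funext A x y
  have hs : ∀ x, Equiv.swap a b (Equiv.swap b c (Equiv.swap a b x)) =
      Equiv.swap b c (Equiv.swap a b (Equiv.swap b c x)) := by
    intro x
    simp only [Equiv.swap_apply_def]
    grind
  have key : ∀ a b c : P, a ≠ b → b ≠ c → a ≠ c →
      antisymmUnit a b (Equiv.swap b c (Equiv.swap a b x)) (Equiv.swap b c (Equiv.swap a b y)) =
        antisymmUnit b c x y := by
    intro a b c hab hbc hac
    have h1 : ∀ x, Equiv.swap b c (Equiv.swap a b x) = a ↔ x = b := by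
      intro x
      rw [Equiv.swap_apply_eq_iff, Equiv.swap_apply_eq_iff,
        Equiv.swap_apply_of_ne_of_ne hab hac, Equiv.swap_apply_left]
    have h2 : ∀ x, Equiv.swap b c (Equiv.swap a b x) = b ↔ x = c := by
      intro x
      rw [Equiv.swap_apply_eq_iff, Equiv.swap_apply_eq_iff, Equiv.swap_apply_left,
        Equiv.swap_apply_of_ne_of_ne hac.symm hbc.symm]
    simp only [antisymmUnit, h1, h2]
  have key' : antisymmUnit b c (Equiv.swap a b (Equiv.swap b c x))
      (Equiv.swap a b (Equiv.swap b c y)) = antisymmUnit a b x y := by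
    have h1 : ∀ x, Equiv.swap a b (Equiv.swap b c x) = c ↔ x = b := by
      intro x
      rw [Equiv.swap_apply_eq_iff, Equiv.swap_apply_eq_iff,
        Equiv.swap_apply_of_ne_of_ne hac.symm hbc.symm, Equiv.swap_apply_right]
    have h2 : ∀ x, Equiv.swap a b (Equiv.swap b c x) = b ↔ x = a := by
      intro x
      rw [Equiv.swap_apply_eq_iff, Equiv.swap_apply_eq_iff, Equiv.swap_apply_right,
        Equiv.swap_apply_of_ne_of_ne hab hac]
    simp only [antisymmUnit, h1, h2]
  have mid : antisymmUnit b c (Equiv.swap a b x) (Equiv.swap a b y) =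
      antisymmUnit a b (Equiv.swap b c x) (Equiv.swap b c y) := by
    simp only [antisymmUnit, Equiv.swap_apply_eq_iff, Equiv.swap_apply_left,
      Equiv.swap_apply_right, Equiv.swap_apply_of_ne_of_ne hab hac,
      Equiv.swap_apply_of_ne_of_ne hac.symm hbc.symm]
  change A _ _ + antisymmUnit a b (Equiv.swap b c (Equiv.swap a b x))
        (Equiv.swap b c (Equiv.swap a b y)) +
      antisymmUnit b c (Equiv.swap a b x) (Equiv.swap a b y) + antisymmUnit a b x y =
    A _ _ + antisymmUnit b c (Equiv.swap a b (Equiv.swap b c x))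
        (Equiv.swap a b (Equiv.swap b c y)) +
      antisymmUnit a b (Equiv.swap b c x) (Equiv.swap b c y) + antisymmUnit b c x y
  rw [key a b c hab hbc hac, key', mid, hs, hs]
  ring

/-- `M` is compatible with the transpositions of `a i` and `b i`: these transpositions commute
when `M i j = 2` and share exactly one point when `M i j = 3`. -/
def IsSwapLabelling (M : CoxeterMatrix B) (a b : B → P) : Prop :=
  (∀ i, a i ≠ b i) ∧ ∀ i j, i ≠ j →
    (M i j = 3 ∧ b i = a j ∧ a i ≠ b j) ∨ (M i j = 3 ∧ b j = a i ∧ a j ≠ b i) ∨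
    (M i j = 2 ∧ a i ≠ a j ∧ a i ≠ b j ∧ b i ≠ a j ∧ b i ≠ b j)

lemma mul_pow_three_eq_one {N : Type*} [Monoid N] {x y : N} (hx : x * x = 1) (hy : y * y = 1)
    (h : x * y * x = y * x * y) : (x * y) ^ 3 = 1 := by
  calc (x * y) ^ 3 = (x * y * x) * (y * x * y) := by
        simp only [pow_succ, pow_zero, one_mul, mul_assoc]
    _ = (x * y * x) * (x * y * x) := by rw [h]
    _ = x * (y * (x * x) * y) * x := by simp only [mul_assoc]
    _ = 1 := by rw [hx, mul_one, hy, mul_one, hx]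

lemma IsSwapLabelling.isLiftable {a b : B → P} (h : IsSwapLabelling M a b) :
    M.IsLiftable fun i => swapShift (a i) (b i) := by
  intro i j
  have hi := swapShift_mul_self (a i) (b i)
  have hj := swapShift_mul_self (a j) (b j)
  rcases eq_or_ne i j with rfl | hij
  · simp [hi]
  rcases h.2 i j hij with ⟨hm, h1, h2⟩ | ⟨hm, h1, h2⟩ | ⟨hm, h1, h2, h3, h4⟩
  · rw [hm]
    refine mul_pow_three_eq_one hi hj ?_
    dsimp only
    rw [← h1]
    exact swapShift_braid (h.1 i) (h1 ▸ h.1 j) h2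
  · rw [hm]
    refine mul_pow_three_eq_one hi hj ?_
    dsimp only
    rw [← h1]
    exact (swapShift_braid (h.1 j) (h1 ▸ h.1 i) h2).symm
  · rw [hm, pow_two, mul_assoc, ← mul_assoc (swapShift (a j) (b j)),
      ← swapShift_commute h1 h2 h3 h4]
    simp only [mul_assoc, hj, mul_one, hi]

variable {a b : B → P}

/-- The action of a Coxeter group on integer matrices in which the `i`-th generator acts as
`swapShift (a i) (b i)`. -/
def swapShiftHom (cs : CoxeterSystem M W) (h : IsSwapLabelling M a b) :
    W →* Function.End (P → P → ℤ) :=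
  cs.lift ⟨_, h.isLiftable⟩

lemma swapShiftHom_simple_mul (cs : CoxeterSystem M W) (h : IsSwapLabelling M a b) (i : B) (w : W)
    (A : P → P → ℤ) :
    swapShiftHom cs h (cs.simple i * w) A = swapShift (a i) (b i) (swapShiftHom cs h w A) := by
  rw [map_mul, swapShiftHom, cs.lift_apply_simple]
  rfl

variable [Fintype P]

lemma absSum_antisymmUnit {a b : P} (h : a ≠ b) : absSum (antisymmUnit a b) = 2 := by
  have key : ∀ x y, |antisymmUnit a b x y| =
      (if x = a then (if y = b then 1 else 0) else 0) +
        (if x = b then (if y = a then 1 else 0) else 0) := by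
    intro x y
    unfold antisymmUnit
    by_cases h1 : x = a ∧ y = b
    · obtain ⟨rfl, rfl⟩ := h1
      simp [h]
    · by_cases h2 : x = b ∧ y = a
      · obtain ⟨rfl, rfl⟩ := h2
        simp [h, h.symm]
      · rw [if_neg h1, if_neg h2]
        split_ifs <;> simp_all
  simp only [absSum, key, Finset.sum_add_distrib]
  simp

lemma absSum_swapShift_le {a b : P} (h : a ≠ b) (A : P → P → ℤ) :
    absSum (swapShift a b A) ≤ absSum A + 2 := by
  rw [← absSum_antisymmUnit h, ← absSum_comp_perm (Equiv.swap a b) A]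
  simp only [absSum, ← Finset.sum_add_distrib]
  exact Finset.sum_le_sum fun x _ => Finset.sum_le_sum fun y _ => abs_add_le _ _

lemma absSum_swapShift_of_eq_zero {a b : P} (h : a ≠ b) {A : P → P → ℤ} (h₁ : A a b = 0)
    (h₂ : A b a = 0) : absSum (swapShift a b A) = absSum A + 2 := by
  rw [← absSum_antisymmUnit h, ← absSum_comp_perm (Equiv.swap a b) A]
  simp only [absSum, ← Finset.sum_add_distrib]
  refine Finset.sum_congr rfl fun x _ => Finset.sum_congr rfl fun y _ => ?_
  unfold swapShift antisymmUnit
  by_cases h1 : x = a ∧ y = b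
  · obtain ⟨rfl, rfl⟩ := h1
    simp [h₂]
  · by_cases h2 : x = b ∧ y = a
    · obtain ⟨rfl, rfl⟩ := h2
      simp [h₁]
    · simp [h1, h2]

lemma absSum_swapShiftHom_le (cs : CoxeterSystem M W) (h : IsSwapLabelling M a b) (w : W) :
    absSum (swapShiftHom cs h w 0) ≤ 2 * cs.length w := by
  obtain ⟨ω, hω, rfl⟩ := cs.exists_isReduced w
  rw [hω.eq]
  clear hω
  induction ω with
  | nil => simp [absSum, Function.End.one_def]
  | cons i ω ih =>
    rw [cs.wordProd_cons, swapShiftHom_simple_mul]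
    have := absSum_swapShift_le (h.1 i) (swapShiftHom cs h (cs.wordProd ω) 0)
    rw [List.length_cons]
    push_cast
    linarith

end Shift

/-- A Coxeter group whose generators are labelled by the transpositions along a cycle is
infinite. -/
lemma infinite_of_isSwapLabelling [Fintype B] [Nonempty B] [DecidableEq B]
    (cs : CoxeterSystem M W) (σ : Equiv.Perm B)
    (h : IsSwapLabelling M id σ) : Infinite W := by
  by_contra hfin
  rw [not_infinite_iff_finite] at hfin
  have := Fintype.ofFinite W
  set C : W → B → B → ℤ := fun w => swapShiftHom cs h w 0 with hC
  set R : B → ℤ := fun x => ∑ w, ∑ y, C w x y with hR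
  have key : ∀ i, R i = R (σ i) + Fintype.card W := by
    intro i
    have hi : i ≠ σ i := h.1 i
    have e : ∀ w, ∑ y, C (cs.simple i * w) i y = ∑ y, C w (σ i) y + 1 := by
      intro w
      simp only [hC, swapShiftHom_simple_mul, swapShift, Finset.sum_add_distrib]
      congr 1
      · simp only [id, Equiv.swap_apply_left]
        exact Equiv.sum_comp (Equiv.swap i (σ i)) fun y => swapShiftHom cs h w 0 (σ i) y
      · simp [antisymmUnit, hi]
    rw [hR]
    simp only
    rw [← Equiv.sum_comp (Equiv.mulLeft (cs.simple i))]
    simp [e, Finset.sum_add_distrib]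
  have hsum : ∑ i, R i = ∑ i, R i + Fintype.card B * Fintype.card W := by
    conv_lhs => rw [Finset.sum_congr rfl fun i _ => key i]
    rw [Finset.sum_add_distrib, Equiv.sum_comp σ R]
    simp
  have h1 : 0 < (Fintype.card B : ℤ) * Fintype.card W := by
    have := Fintype.card_pos (α := B)
    have := Fintype.card_pos (α := W)
    positivity
  linarith

section NormalForm

/-- The length of the maximal run of consecutive elements of `K` ending at `k - 1`. -/
def run (K : Finset ℕ) : ℕ → ℕ
  | 0 => 0
  | k + 1 => if k ∈ K then run K k + 1 else 0

lemma le_run_iff {K : Finset ℕ} {k r : ℕ} :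
    r ≤ run K k ↔ r ≤ k ∧ ∀ i < k, k ≤ i + r → i ∈ K := by
  induction k generalizing r with
  | zero => simp [run]
  | succ k ih =>
    rw [run]
    split_ifs with hk
    · cases r with
      | zero => simp; omega
      | succ r =>
        rw [Nat.succ_le_succ_iff, ih]
        refine and_congr (by omega) ⟨fun h i hi hr => ?_, fun h i hi hr => h i (by omega) (by omega)⟩
        rcases eq_or_ne i k with rfl | hik
        · exact hk
        · exact h i (by omega) (by omega)
    · constructor
      · intro h
        obtain rfl : r = 0 := by omega
        exact ⟨by omega, fun i hi hr => by omega⟩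
      · rintro ⟨h1, h2⟩
        by_contra hr
        exact hk (h2 k (by omega) (by omega))

variable {G : Type*} [Group G]

/-- The relations of the Coxeter group of type `A` among the first `n` terms of `s`. -/
structure IsBraidPath (s : ℕ → G) (n : ℕ) : Prop where
  mul_self : ∀ i < n, s i * s i = 1
  commute : ∀ i j, i + 1 < j → j < n → s i * s j = s j * s i
  braid : ∀ i, i + 1 < n → s i * s (i + 1) * s i = s (i + 1) * s i * s (i + 1)

/-- The product `s (k - 1) * s (k - 2) * ⋯ * s (k - r)`. -/
def descProd (s : ℕ → G) : ℕ → ℕ → G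
  | _, 0 => 1
  | 0, _ + 1 => 1
  | k + 1, r + 1 => s k * descProd s k r

@[simp] lemma descProd_zero (s : ℕ → G) (k : ℕ) : descProd s k 0 = 1 := by
  cases k <;> rfl

lemma descProd_succ (s : ℕ → G) {k r : ℕ} (h : r < k) :
    descProd s k (r + 1) = descProd s k r * s (k - r - 1) := by
  induction k generalizing r with
  | zero => omega
  | succ k ih =>
    cases r with
    | zero => simp [descProd]
    | succ r =>
      rw [descProd, ih (by omega), descProd, mul_assoc]
      congr 3
      omega

namespace IsBraidPath

variable {s : ℕ → G} {n : ℕ}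

lemma descProd_mul_of_lt (hs : IsBraidPath s n) {k r i : ℕ} (hk : k ≤ n) (hi : i + r + 1 < k) :
    descProd s k r * s i = s i * descProd s k r := by
  induction k generalizing r with
  | zero => omega
  | succ k ih =>
    cases r with
    | zero => simp
    | succ r =>
      rw [descProd, mul_assoc, ih (by omega) (by omega), ← mul_assoc, ← mul_assoc,
        hs.commute i k (by omega) (by omega)]

lemma descProd_mul_of_gt (hs : IsBraidPath s n) {k r j : ℕ} (hr : r ≤ k) (hkj : k < j) (hj : j < n) :
    descProd s k r * s j = s j * descProd s k r := by
  induction k generalizing r with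
  | zero =>
    obtain rfl : r = 0 := by omega
    simp
  | succ k ih =>
    cases r with
    | zero => simp
    | succ r =>
      rw [descProd, mul_assoc, ih (by omega) (by omega), ← mul_assoc, ← mul_assoc,
        hs.commute k j (by omega) (by omega)]

lemma descProd_mul_succ (hs : IsBraidPath s n) {k r i : ℕ} (hk : k ≤ n) (hr : r ≤ k)
    (hi : k ≤ i + r) (hik : i + 2 ≤ k) :
    descProd s k r * s (i + 1) = s i * descProd s k r := by
  induction k generalizing r with
  | zero => omega
  | succ k ih =>
    cases r with
    | zero => omega
    | succ r =>
      rcases eq_or_ne k (i + 1) with rfl | hne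
      · cases r with
        | zero => omega
        | succ r =>
          simp only [descProd]
          rw [mul_assoc, mul_assoc, hs.descProd_mul_of_gt (by omega) (by omega) (by omega)]
          simp only [← mul_assoc]
          rw [hs.braid i (by omega)]
      · rw [descProd, mul_assoc, ih (by omega) (by omega) (by omega) (by omega),
          ← mul_assoc, ← mul_assoc, hs.commute i k (by omega) (by omega)]

end IsBraidPath

/-- The products `∏ k, descProd s (k + 1) (r k)` with `r k ≤ run K (k + 1)`. -/
def normalForms (s : ℕ → G) (K : Finset ℕ) : ℕ → Set G
  | 0 => {1}
  | k + 1 => {g | ∃ x ∈ normalForms s K k, ∃ r ≤ run K (k + 1), g = x * descProd s (k + 1) r}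

lemma one_mem_normalForms (s : ℕ → G) (K : Finset ℕ) (k : ℕ) : 1 ∈ normalForms s K k := by
  induction k with
  | zero => exact Set.mem_singleton 1
  | succ k ih => exact ⟨1, ih, 0, by simp, by simp⟩

lemma finite_normalForms (s : ℕ → G) (K : Finset ℕ) (k : ℕ) : (normalForms s K k).Finite := by
  induction k with
  | zero => exact Set.finite_singleton 1
  | succ k ih =>
    refine (Set.Finite.image2 (fun x r => x * descProd s (k + 1) r) ih
      (Set.finite_Iic (run K (k + 1)))).subset ?_
    rintro g ⟨x, hx, r, hr, rfl⟩
    exact ⟨x, hx, r, hr, rfl⟩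

lemma IsBraidPath.mul_mem_normalForms {s : ℕ → G} {n : ℕ} (hs : IsBraidPath s n) {K : Finset ℕ}
    {k : ℕ} (hk : k ≤ n) {g : G} (hg : g ∈ normalForms s K k) {i : ℕ} (hi : i < k) (hiK : i ∈ K) :
    g * s i ∈ normalForms s K k := by
  induction k generalizing g i with
  | zero => omega
  | succ k ih =>
    obtain ⟨x, hx, r, hr, rfl⟩ := hg
    have hr' := le_run_iff.1 hr
    rw [mul_assoc]
    rcases lt_trichotomy (i + r) k with h | h | h
    · rw [hs.descProd_mul_of_lt hk (by omega), ← mul_assoc]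
      exact ⟨_, ih (by omega) hx (by omega) hiK, r, hr, rfl⟩
    · refine ⟨x, hx, r + 1, le_run_iff.2 ⟨by omega, fun j hj hjr => ?_⟩, ?_⟩
      · rcases eq_or_ne j i with rfl | hji
        · exact hiK
        · exact hr'.2 j hj (by omega)
      · rw [descProd_succ s (by omega)]
        congr 3
        omega
    · rcases eq_or_ne (i + r) (k + 1) with h' | h'
      · obtain ⟨r, rfl⟩ : ∃ r', r = r' + 1 := ⟨r - 1, by omega⟩
        refine ⟨x, hx, r, by omega, ?_⟩
        rw [descProd_succ s (by omega), mul_assoc, show k + 1 - r - 1 = i by omega,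
          hs.mul_self i (by omega), mul_one]
      · obtain ⟨i, rfl⟩ : ∃ i', i = i' + 1 := ⟨i - 1, by omega⟩
        rw [hs.descProd_mul_succ hk (by omega) (by omega) (by omega), ← mul_assoc]
        exact ⟨_, ih (by omega) hx (by omega) (hr'.2 i (by omega) (by omega)), r, hr, rfl⟩

lemma IsBraidPath.closure_subset_normalForms {s : ℕ → G} {n : ℕ} (hs : IsBraidPath s n)
    {K : Finset ℕ} (hK : K ⊆ Finset.range n) :
    (Subgroup.closure (s '' K) : Set G) ⊆ normalForms s K n := by
  intro g hg
  have hmem : ∀ i ∈ K, i < n := fun i hi => Finset.mem_range.1 (hK hi)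
  induction hg using Subgroup.closure_induction_right with
  | one => exact one_mem_normalForms s K n
  | mul_right x hx y hy h =>
    obtain ⟨i, hi, rfl⟩ := hy
    exact hs.mul_mem_normalForms le_rfl h (hmem i hi) hi
  | mul_inv_cancel x hx y hy h =>
    obtain ⟨i, hi, rfl⟩ := hy
    rw [inv_eq_of_mul_eq_one_left (hs.mul_self i (hmem i hi))]
    exact hs.mul_mem_normalForms le_rfl h (hmem i hi) hi

/-- The product `s (k - r) * ⋯ * s (k - 2) * s (k - 1)`. -/
def ascProd (s : ℕ → G) (k : ℕ) : ℕ → G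
  | 0 => 1
  | r + 1 => s (k - (r + 1)) * ascProd s k r

/-- The product of the longest of the factors `ascProd s (j + 1) r` for `j < k`. -/
def maxProd (s : ℕ → G) (K : Finset ℕ) : ℕ → G
  | 0 => 1
  | k + 1 => ascProd s (k + 1) (run K (k + 1)) * maxProd s K k

lemma ascProd_mem_closure (s : ℕ → G) (K : Finset ℕ) {k r : ℕ} (hr : r ≤ run K k) :
    ascProd s k r ∈ Subgroup.closure (s '' K) := by
  induction r with
  | zero => exact one_mem _
  | succ r ih =>
    have := le_run_iff.1 hr
    exact mul_mem (Subgroup.subset_closure ⟨_, this.2 _ (by omega) (by omega), rfl⟩)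
      (ih (by omega))

lemma maxProd_mem_closure (s : ℕ → G) (K : Finset ℕ) (k : ℕ) :
    maxProd s K k ∈ Subgroup.closure (s '' K) := by
  induction k with
  | zero => exact one_mem _
  | succ k ih => exact mul_mem (ascProd_mem_closure s K le_rfl) ih

end NormalForm

section Length

variable {P : Type*} {a b : B → P}

/-- The generators `s 0, …, s (n - 1)` are labelled by the transpositions along the path
`p 0, …, p n` of pairwise distinct points. -/
structure IsLabelledPath (cs : CoxeterSystem M W) (a b : B → P) (s : ℕ → W) (p : ℕ → P) (n : ℕ) :
    Prop where
  exists_simple : ∀ k < n, ∃ i, s k = cs.simple i ∧ a i = p k ∧ b i = p (k + 1)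
  inj : ∀ i ≤ n, ∀ j ≤ n, p i = p j → i = j

namespace IsLabelledPath

variable {cs : CoxeterSystem M W} {s : ℕ → W} {p : ℕ → P} {n : ℕ}

lemma isBraidPath (h : IsLabelledPath cs a b s p n) (hM : IsSwapLabelling M a b) :
    IsBraidPath s n where
  mul_self i hi := by
    obtain ⟨i', h1, -⟩ := h.exists_simple i hi
    rw [h1, cs.simple_mul_simple_self]
  commute i j hij hj := by
    obtain ⟨i', h1, h2, h3⟩ := h.exists_simple i (by omega)
    obtain ⟨j', h4, h5, h6⟩ := h.exists_simple j hj
    have hne : i' ≠ j' := by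
      rintro rfl
      have := h.inj i (by omega) j (by omega) (h2.symm.trans h5)
      omega
    rcases hM.2 i' j' hne with ⟨-, h7, -⟩ | ⟨-, h7, -⟩ | ⟨hm, -⟩
    · have := h.inj (i + 1) (by omega) j (by omega) (by rw [← h3, h7, h5])
      omega
    · have := h.inj (j + 1) (by omega) i (by omega) (by rw [← h6, h7, h2])
      omega
    · have := cs.simple_mul_simple_pow i' j'
      rw [hm, pow_two, ← h1, ← h4] at this
      rw [mul_eq_one_iff_eq_inv, mul_inv_rev, h1, h4, cs.inv_simple, cs.inv_simple] at this
      rw [h1, h4, this]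
  braid i hi := by
    obtain ⟨i', h1, h2, h3⟩ := h.exists_simple i (by omega)
    obtain ⟨j', h4, h5, h6⟩ := h.exists_simple (i + 1) hi
    have hne : i' ≠ j' := by
      rintro rfl
      have := h.inj i (by omega) (i + 1) (by omega) (h2.symm.trans h5)
      omega
    have hm : M i' j' = 3 := by
      rcases hM.2 i' j' hne with ⟨h7, -⟩ | ⟨h7, -⟩ | ⟨-, -, -, h7, -⟩
      · exact h7
      · exact h7
      · exact absurd (h3.trans h5.symm) h7
    have := cs.simple_mul_simple_pow i' j'
    rw [hm, pow_succ, pow_two, ← h1, ← h4] at this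
    have e : s i * s (i + 1) * s i * (s (i + 1) * s i * s (i + 1)) = 1 := by
      rw [← this]
      simp only [mul_assoc]
    rw [mul_eq_one_iff_eq_inv] at e
    rw [e]
    simp only [mul_inv_rev, mul_assoc, h1, h4, cs.inv_simple]

lemma length_le_one (h : IsLabelledPath cs a b s p n) {k : ℕ} (hk : k < n) :
    cs.length (s k) ≤ 1 := by
  obtain ⟨i, hi, -⟩ := h.exists_simple k hk
  rw [hi, cs.length_simple]

lemma length_descProd_le (h : IsLabelledPath cs a b s p n) {k r : ℕ} (hk : k ≤ n) :
    cs.length (descProd s k r) ≤ r := by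
  induction k generalizing r with
  | zero => cases r <;> simp [descProd]
  | succ k ih =>
    cases r with
    | zero => simp
    | succ r =>
      have h1 := cs.length_mul_le (s k) (descProd s k r)
      have h2 := h.length_le_one (k := k) (by omega)
      have h3 := ih (r := r) (by omega)
      rw [descProd]
      omega

lemma length_le_of_mem_normalForms (h : IsLabelledPath cs a b s p n) {K : Finset ℕ} {k : ℕ}
    (hk : k ≤ n) {g : W} (hg : g ∈ normalForms s K k) :
    cs.length g ≤ ∑ i ∈ Finset.range k, run K (i + 1) := by
  induction k generalizing g with
  | zero =>
    rw [normalForms, Set.mem_singleton_iff] at hg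
    simp [hg]
  | succ k ih =>
    obtain ⟨x, hx, r, hr, rfl⟩ := hg
    have h1 := cs.length_mul_le x (descProd s (k + 1) r)
    have h2 := ih (by omega) hx
    have h3 := h.length_descProd_le (r := r) hk
    rw [Finset.sum_range_succ]
    omega

lemma finite_parabolic (h : IsLabelledPath cs a b s p n) (hM : IsSwapLabelling M a b)
    {K : Finset ℕ} (hK : K ⊆ Finset.range n) {J : Set B} (hJ : cs.simple '' J = s '' K) :
    (parabolic cs J : Set W).Finite := by
  rw [parabolic, hJ]
  exact (finite_normalForms s K n).subset ((h.isBraidPath hM).closure_subset_normalForms hK)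

variable [DecidableEq P] [Fintype P]

lemma absSum_ascProd (h : IsLabelledPath cs a b s p n) (hM : IsSwapLabelling M a b) {k r : ℕ}
    (hk : k ≤ n) (hr : r ≤ k) {A : P → P → ℤ}
    (hA : ∀ m, k ≤ m → m ≤ n → ∀ x, A x (p m) = 0 ∧ A (p m) x = 0) :
    absSum (swapShiftHom cs hM (ascProd s k r) A) = absSum A + 2 * r ∧
    (∀ i < k - r, swapShiftHom cs hM (ascProd s k r) A (p i) (p (k - r)) = 0 ∧
      swapShiftHom cs hM (ascProd s k r) A (p (k - r)) (p i) = 0) ∧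
    ∀ m, k < m → m ≤ n → ∀ x, swapShiftHom cs hM (ascProd s k r) A x (p m) = 0 ∧
      swapShiftHom cs hM (ascProd s k r) A (p m) x = 0 := by
  induction r with
  | zero =>
    simp only [ascProd, map_one, Function.End.one_def, id]
    refine ⟨by simp, fun i _ => (hA k le_rfl hk (p i)), fun m hm => hA m hm.le⟩
  | succ r ih =>
    obtain ⟨h1, h2, h3⟩ := ih (by omega)
    obtain ⟨j, hj⟩ : ∃ j, k - (r + 1) = j := ⟨_, rfl⟩
    rw [show k - r = j + 1 by omega] at h2
    obtain ⟨i', e1, e2, e3⟩ := h.exists_simple j (by omega)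
    have hne : ∀ i ≤ n, ∀ m ≤ n, i ≠ m → p i ≠ p m := fun i hi m hm him he => him (h.inj i hi m hm he)
    rw [ascProd, hj, e1, swapShiftHom_simple_mul, e2, e3]
    have hjj := hne j (by omega) (j + 1) (by omega) (by omega)
    refine ⟨?_, fun i hi => ?_, fun m hm hmn x => ?_⟩
    · rw [absSum_swapShift_of_eq_zero hjj (h2 j (by omega)).1 (h2 j (by omega)).2, h1]
      push_cast
      ring
    · have n1 := hne i (by omega) j (by omega) (by omega)
      have n2 := hne i (by omega) (j + 1) (by omega) (by omega)
      simp only [swapShift, antisymmUnit, Equiv.swap_apply_left,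
        Equiv.swap_apply_of_ne_of_ne n1 n2, h2 i (by omega), n1, n2]
      simp
    · have n1 := hne m (by omega) j (by omega) (by omega)
      have n2 := hne m (by omega) (j + 1) (by omega) (by omega)
      simp only [swapShift, antisymmUnit, Equiv.swap_apply_of_ne_of_ne n1 n2,
        h3 m hm hmn, n1, n2]
      simp

lemma absSum_maxProd (h : IsLabelledPath cs a b s p n) (hM : IsSwapLabelling M a b)
    (K : Finset ℕ) {k : ℕ} (hk : k ≤ n) :
    absSum (swapShiftHom cs hM (maxProd s K k) 0) =
      2 * ∑ i ∈ Finset.range k, (run K (i + 1) : ℤ) ∧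
    ∀ m, k < m → m ≤ n → ∀ x, swapShiftHom cs hM (maxProd s K k) 0 x (p m) = 0 ∧
      swapShiftHom cs hM (maxProd s K k) 0 (p m) x = 0 := by
  induction k with
  | zero => simp [maxProd, absSum, Function.End.one_def]
  | succ k ih =>
    obtain ⟨h1, h2⟩ := ih (by omega)
    obtain ⟨h3, -, h4⟩ := h.absSum_ascProd hM hk (le_run_iff.1 (le_refl (run K (k + 1)))).1
      (A := swapShiftHom cs hM (maxProd s K k) 0) h2
    have e : swapShiftHom cs hM (maxProd s K (k + 1)) 0 =
        swapShiftHom cs hM (ascProd s (k + 1) (run K (k + 1)))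
          (swapShiftHom cs hM (maxProd s K k) 0) := by
      rw [maxProd, map_mul]
      rfl
    rw [e]
    refine ⟨?_, h4⟩
    rw [h3, h1, Finset.sum_range_succ]
    ring

lemma length_maxProd (h : IsLabelledPath cs a b s p n) (hM : IsSwapLabelling M a b)
    (K : Finset ℕ) : ∑ i ∈ Finset.range n, run K (i + 1) ≤ cs.length (maxProd s K n) := by
  have h1 := absSum_swapShiftHom_le cs hM (maxProd s K n)
  rw [(h.absSum_maxProd hM K le_rfl).1] at h1
  have : ((∑ i ∈ Finset.range n, run K (i + 1) : ℕ) : ℤ) ≤ cs.length (maxProd s K n) := by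
    push_cast
    linarith
  exact_mod_cast this

lemma length_w0 (h : IsLabelledPath cs a b s p n) (hM : IsSwapLabelling M a b)
    {K : Finset ℕ} (hK : K ⊆ Finset.range n) {J : Set B} (hJ : cs.simple '' J = s '' K) :
    cs.length (w0 cs J) = ∑ i ∈ Finset.range n, run K (i + 1) := by
  have hle : ∀ u ∈ parabolic cs J, cs.length u ≤ ∑ i ∈ Finset.range n, run K (i + 1) := by
    intro u hu
    rw [parabolic, hJ] at hu
    exact h.length_le_of_mem_normalForms le_rfl
      ((h.isBraidPath hM).closure_subset_normalForms hK hu)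
  have hmem : maxProd s K n ∈ parabolic cs J := by
    rw [parabolic, hJ]
    exact maxProd_mem_closure s K n
  have hex : ∃ w ∈ parabolic cs J, ∀ u ∈ parabolic cs J, cs.length u ≤ cs.length w :=
    ⟨_, hmem, fun u hu => (hle u hu).trans (h.length_maxProd hM K)⟩
  rw [w0, dif_pos hex]
  exact le_antisymm (hle _ hex.choose_spec.1)
    ((h.length_maxProd hM K).trans (hex.choose_spec.2 _ hmem))

end IsLabelledPath

end Length

section Labellings

lemma isSwapLabelling_A (n : ℕ) :
    IsSwapLabelling (CoxeterMatrix.A n) Fin.castSucc (Fin.succ : Fin n → Fin (n + 1)) := by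
  refine ⟨fun i => (Fin.castSucc_lt_succ (i := i)).ne, fun i j hij => ?_⟩
  have hij' : (i : ℕ) ≠ j := fun h => hij (Fin.ext h)
  simp only [CoxeterMatrix.A, Matrix.of_apply, Fin.ext_iff, Fin.val_succ,
    Fin.val_castSucc, ne_eq]
  split_ifs <;> omega

lemma val_finRotate {n : ℕ} (i : Fin (n + 1)) :
    (finRotate (n + 1) i : ℕ) = if (i : ℕ) = n then 0 else (i : ℕ) + 1 := by
  rw [finRotate_apply, Fin.val_add_one]
  simp only [Fin.ext_iff, Fin.val_last]

lemma isSwapLabelling_tAmat {n : ℕ} (hn : 2 ≤ n) :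
    IsSwapLabelling (tAmat n) id (finRotate (n + 1)) := by
  refine ⟨fun i h => ?_, fun i j hij => ?_⟩
  · rw [id, Fin.ext_iff, val_finRotate] at h
    split_ifs at h <;> omega
  · have hij' : (i : ℕ) ≠ j := fun h => hij (Fin.ext h)
    simp only [tAmat, Matrix.of_apply, Fin.ext_iff, val_finRotate, ne_eq, id]
    have := i.2
    have := j.2
    rcases le_total (i : ℕ) j with h | h
    · rw [min_eq_left h, max_eq_right h]
      split_ifs <;> first | omega | (simp only [not_false_eq_true, and_true, true_and]; omega)
    · rw [min_eq_right h, max_eq_left h]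
      split_ifs <;> first | omega | (simp only [not_false_eq_true, and_true, true_and]; omega)

/-- The vertices `j + 1, j + 2, …` of the cycle on `Fin (n + 1)`. -/
def cyc (n j k : ℕ) : Fin (n + 1) := Fin.ofNat (n + 1) (j + 1 + k)

lemma val_cyc {n j k : ℕ} (hj : j ≤ n) (hk : k ≤ n) :
    (cyc n j k : ℕ) = if j + 1 + k ≤ n then j + 1 + k else j + k - n := by
  rw [cyc, Fin.val_ofNat]
  split_ifs with h
  · exact Nat.mod_eq_of_lt (by omega)
  · rw [Nat.mod_eq_sub_mod (by omega), Nat.mod_eq_of_lt (by omega)]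
    omega

lemma cyc_injOn {n j : ℕ} (hj : j ≤ n) {k l : ℕ} (hk : k ≤ n) (hl : l ≤ n)
    (h : cyc n j k = cyc n j l) : k = l := by
  rw [Fin.ext_iff, val_cyc hj hk, val_cyc hj hl] at h
  split_ifs at h <;> omega

lemma isLabelledPath_tAmat {n j : ℕ} (hj : j ≤ n) :
    IsLabelledPath (tAmat n).toCoxeterSystem id (finRotate (n + 1))
      (fun k => (tAmat n).toCoxeterSystem.simple (cyc n j k)) (cyc n j) n where
  exists_simple k hk := by
    refine ⟨_, rfl, rfl, ?_⟩
    rw [Fin.ext_iff, val_finRotate, val_cyc hj hk.le, val_cyc hj (by omega)]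
    split_ifs <;> omega
  inj k hk l hl h := cyc_injOn hj hk hl h

lemma isLabelledPath_A (n : ℕ) :
    IsLabelledPath (CoxeterMatrix.A n).toCoxeterSystem Fin.castSucc
      (Fin.succ : Fin n → Fin (n + 1))
      (fun k => if h : k < n then (CoxeterMatrix.A n).toCoxeterSystem.simple ⟨k, h⟩ else 1)
      (Fin.ofNat (n + 1)) n where
  exists_simple k hk := by
    refine ⟨⟨k, hk⟩, dif_pos hk, ?_, ?_⟩ <;> simp only [Fin.ext_iff, Fin.val_ofNat,
      Fin.val_castSucc, Fin.val_succ] <;> rw [Nat.mod_eq_of_lt (by omega)]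
  inj k hk l hl h := by
    simp only [Fin.ext_iff, Fin.val_ofNat] at h
    rwa [Nat.mod_eq_of_lt (by omega), Nat.mod_eq_of_lt (by omega)] at h

end Labellings

section Sums

/-- The summand of a subset `K` of a path with vertices `0, …, n - 1` in the characteristic
polynomial. -/
noncomputable def pathTerm (n : ℕ) (K : Finset ℕ) : ℤ[X] :=
  (-1) ^ K.card * X ^ ∑ i ∈ Finset.range n, run K (i + 1)

lemma lenA_eq {n : ℕ} (J : Finset (Fin n)) :
    lenA n J = ∑ i ∈ Finset.range n, run (J.map Fin.valEmbedding) (i + 1) := by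
  refine (isLabelledPath_A n).length_w0 (isSwapLabelling_A n) (fun i hi => ?_) ?_
  · obtain ⟨j, -, rfl⟩ := Finset.mem_map.1 hi
    exact Finset.mem_range.2 j.2
  · rw [Finset.coe_map, Set.image_image]
    refine Set.image_congr fun i _ => ?_
    rw [Fin.valEmbedding_apply, dif_pos i.2]

lemma chiA_eq (n : ℕ) : chiA n = ∑ K ∈ (Finset.range n).powerset, pathTerm n K := by
  refine Finset.sum_nbij (fun J => J.map Fin.valEmbedding) (fun J _ => ?_) ?_ ?_ fun J _ => ?_
  · refine Finset.mem_powerset.2 fun i hi => ?_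
    obtain ⟨j, -, rfl⟩ := Finset.mem_map.1 hi
    exact Finset.mem_range.2 j.2
  · exact (Finset.map_injective _).injOn
  · intro K hK
    have hK' : ∀ i ∈ K, i < n := fun i hi =>
      Finset.mem_range.1 (Finset.mem_powerset.1 (Finset.mem_coe.1 hK) hi)
    refine ⟨K.attachFin hK', by simp, Finset.ext fun i => ?_⟩
    simp only [Finset.mem_map, Finset.mem_attachFin, Fin.valEmbedding_apply]
    exact ⟨fun ⟨j, hj, e⟩ => e ▸ hj, fun hi => ⟨⟨i, hK' i hi⟩, hi, rfl⟩⟩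
  · rw [pathTerm, Finset.card_map, lenA_eq]

lemma run_congr {K L : Finset ℕ} {k : ℕ} (h : ∀ i < k, i ∈ K ↔ i ∈ L) : run K k = run L k := by
  induction k with
  | zero => rfl
  | succ k ih =>
    simp only [run, h k k.lt_succ_self, ih fun i hi => h i (by omega)]

lemma pathTerm_succ_of_subset {n : ℕ} {K : Finset ℕ} (hK : K ⊆ Finset.range n) :
    pathTerm (n + 1) K = pathTerm n K := by
  have : n ∉ K := fun h => absurd (hK h) Finset.notMem_range_self
  rw [pathTerm, Finset.sum_range_succ, run, if_neg this, add_zero, pathTerm]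

lemma run_insert_succ {n : ℕ} (K : Finset ℕ) : run (insert n K) (n + 1) = run K n + 1 := by
  rw [run, if_pos (Finset.mem_insert_self n K)]
  congr 1
  refine run_congr fun i hi => ?_
  simp [hi.ne]

lemma pathTerm_succ_insert {n : ℕ} {K : Finset ℕ} (hK : K ⊆ Finset.range n) :
    pathTerm (n + 1) (insert n K) = -X ^ (run K n + 1) * pathTerm n K := by
  have hn : n ∉ K := fun h => absurd (hK h) Finset.notMem_range_self
  have : ∑ i ∈ Finset.range n, run (insert n K) (i + 1) = ∑ i ∈ Finset.range n, run K (i + 1) := by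
    refine Finset.sum_congr rfl fun i hi => run_congr fun l hl => ?_
    have := Finset.mem_range.1 hi
    simp [show l ≠ n by omega]
  rw [pathTerm, pathTerm, Finset.card_insert_of_notMem hn, Finset.sum_range_succ, this,
    run_insert_succ]
  ring

/-- The subsets of a path whose final run has length `k` contribute the contribution of that run
times the characteristic polynomial of the path without the run and its boundary. -/
lemma sum_pathTerm_run_eq {n k : ℕ} (hk : k ≤ n) :
    ∑ K ∈ (Finset.range n).powerset with run K n = k, pathTerm n K =
      (-1) ^ k * X ^ (k + 1).choose 2 * chiA (n - k - 1) := by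
  induction k generalizing n with
  | zero =>
    cases n with
    | zero => simp [chiA_eq, run]
    | succ n =>
      rw [Finset.sum_filter, Finset.range_add_one,
        Finset.sum_powerset_insert Finset.notMem_range_self]
      simp only [run_insert_succ, Nat.succ_ne_zero, if_false, Finset.sum_const_zero, add_zero]
      rw [show n + 1 - 0 - 1 = n by omega, chiA_eq]
      simp only [pow_zero, zero_add, one_mul, Nat.choose_eq_zero_of_lt one_lt_two]
      refine Finset.sum_congr rfl fun K hK => ?_
      have hK' := Finset.mem_powerset.1 hK
      have : n ∉ K := fun h => absurd (hK' h) Finset.notMem_range_self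
      rw [if_pos (by simp [run, this]), pathTerm_succ_of_subset hK']
  | succ k ih =>
    obtain ⟨n, rfl⟩ : ∃ n', n = n' + 1 := ⟨n - 1, by omega⟩
    rw [Finset.sum_filter, Finset.range_add_one,
      Finset.sum_powerset_insert Finset.notMem_range_self]
    have h0 : ∑ K ∈ (Finset.range n).powerset,
        (if run K (n + 1) = k + 1 then pathTerm (n + 1) K else 0) = 0 := by
      refine Finset.sum_eq_zero fun K hK => if_neg ?_
      have : n ∉ K := fun h => absurd (Finset.mem_powerset.1 hK h) Finset.notMem_range_self
      simp [run, this]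
    rw [h0, zero_add]
    have h1 : ∀ K ∈ (Finset.range n).powerset,
        (if run (insert n K) (n + 1) = k + 1 then pathTerm (n + 1) (insert n K) else 0) =
          -X ^ (k + 1) * if run K n = k then pathTerm n K else 0 := by
      intro K hK
      rw [run_insert_succ, pathTerm_succ_insert (Finset.mem_powerset.1 hK)]
      by_cases h : run K n = k <;> simp [h]
    rw [Finset.sum_congr rfl h1, ← Finset.mul_sum, ← Finset.sum_filter, ih (by omega),
      show n + 1 - (k + 1) - 1 = n - k - 1 by omega, Nat.choose_succ_succ' (k + 1) 1,
      Nat.choose_one_right, pow_add X (k + 1), pow_succ (-1 : ℤ[X]) k]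
    ring

lemma sum_pathTerm_le_run (n : ℕ) :
    ∑ j ∈ Finset.range n, ∑ K ∈ (Finset.range n).powerset with j + 1 ≤ run K n, pathTerm n K =
      ∑ k ∈ Finset.Icc 1 n, (k : ℤ[X]) * (-1) ^ k * X ^ (k + 1).choose 2 * chiA (n - k - 1) := by
  have hle : ∀ K, run K n ≤ n := fun K => (le_run_iff.1 le_rfl).1
  have h1 : ∑ j ∈ Finset.range n,
      ∑ K ∈ (Finset.range n).powerset with j + 1 ≤ run K n, pathTerm n K =
      ∑ K ∈ (Finset.range n).powerset, (run K n : ℤ[X]) * pathTerm n K := by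
    simp only [Finset.sum_filter]
    rw [Finset.sum_comm]
    refine Finset.sum_congr rfl fun K _ => ?_
    rw [← Finset.sum_filter, Finset.sum_const, nsmul_eq_mul,
      show (Finset.range n).filter (fun j => j + 1 ≤ run K n) = Finset.range (run K n) from ?_,
      Finset.card_range]
    ext j
    have := hle K
    simp only [Finset.mem_filter, Finset.mem_range]
    omega
  rw [h1, ← Finset.sum_fiberwise_of_maps_to (t := Finset.range (n + 1)) (g := fun K => run K n)
    (fun K _ => Finset.mem_range.2 (Nat.lt_succ_of_le (hle K)))]
  have h2 : ∀ k ∈ Finset.range (n + 1),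
      ∑ K ∈ (Finset.range n).powerset with run K n = k, (run K n : ℤ[X]) * pathTerm n K =
        (k : ℤ[X]) * (-1) ^ k * X ^ (k + 1).choose 2 * chiA (n - k - 1) := by
    intro k hk
    have e : ∀ K ∈ (Finset.range n).powerset.filter (fun K => run K n = k),
        (run K n : ℤ[X]) * pathTerm n K = k * pathTerm n K := by
      intro K hK
      rw [(Finset.mem_filter.1 hK).2]
    rw [Finset.sum_congr rfl e, ← Finset.mul_sum,
      sum_pathTerm_run_eq (Nat.lt_succ_iff.1 (Finset.mem_range.1 hk))]
    ring
  rw [Finset.sum_congr rfl h2]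
  symm
  refine Finset.sum_subset (fun k hk => ?_) fun k hk hk' => ?_
  · rw [Finset.mem_Icc] at hk
    exact Finset.mem_range.2 (by omega)
  · rw [Finset.mem_Icc] at hk'
    rw [Finset.mem_range] at hk
    obtain rfl : k = 0 := by omega
    simp

/-- The summand of `J` in the characteristic polynomial of the affine Coxeter group `Ãₙ`. -/
noncomputable def affTerm (n : ℕ) (J : Finset (Fin (n + 1))) : ℤ[X] :=
  (-1) ^ J.card *
    X ^ (tAmat n).toCoxeterSystem.length (w0 (tAmat n).toCoxeterSystem (↑J : Set (Fin (n + 1))))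

/-- The subset of the path `j + 1, …, n, 0, …, j - 1` corresponding to `J`. -/
def cutAt (n j : ℕ) (J : Finset (Fin (n + 1))) : Finset ℕ :=
  (Finset.range n).filter fun k => cyc n j k ∈ J

lemma image_cyc_cutAt {n : ℕ} {j : Fin (n + 1)} {J : Finset (Fin (n + 1))} (hj : j ∉ J) :
    (cutAt n j J).image (cyc n j) = J := by
  ext i
  simp only [cutAt, Finset.mem_image, Finset.mem_filter, Finset.mem_range]
  constructor
  · rintro ⟨k, hk, rfl⟩
    exact hk.2
  · intro hi
    have hij : (i : ℕ) ≠ j := fun h => hj (Fin.ext h ▸ hi)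
    have := i.2
    have := j.2
    have key : ∀ k < n, (if (j : ℕ) + 1 + k ≤ n then (j : ℕ) + 1 + k else j + k - n) = i →
        ∃ a, (a < n ∧ cyc n j a ∈ J) ∧ cyc n j a = i := by
      intro k hk h
      have e : cyc n j k = i := Fin.ext (by rw [val_cyc (by omega) (by omega), h])
      exact ⟨k, ⟨hk, e ▸ hi⟩, e⟩
    rcases lt_or_gt_of_ne hij with h | h
    · exact key (n - j + i) (by omega) (by split_ifs <;> omega)
    · exact key (i - j - 1) (by omega) (by split_ifs <;> omega)

lemma cutAt_image_cyc {n : ℕ} {j : Fin (n + 1)} {K : Finset ℕ} (hK : K ⊆ Finset.range n) :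
    cutAt n j (K.image (cyc n j)) = K := by
  ext k
  have hK' : ∀ i ∈ K, i < n := fun i hi => Finset.mem_range.1 (hK hi)
  simp only [cutAt, Finset.mem_image, Finset.mem_filter, Finset.mem_range]
  constructor
  · rintro ⟨hk, l, hl, e⟩
    rwa [← cyc_injOn (Nat.lt_succ_iff.1 j.2) (hK' l hl).le hk.le e]
  · exact fun hk => ⟨hK' k hk, k, hk, rfl⟩

lemma notMem_image_cyc {n : ℕ} {j : Fin (n + 1)} {K : Finset ℕ} (hK : K ⊆ Finset.range n) :
    j ∉ K.image (cyc n j) := by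
  intro h
  obtain ⟨k, hk, e⟩ := Finset.mem_image.1 h
  have hkn := Finset.mem_range.1 (hK hk)
  have := j.2
  rw [Fin.ext_iff, val_cyc (by omega) (by omega)] at e
  split_ifs at e <;> omega

lemma simple_image_cutAt {n : ℕ} {j : Fin (n + 1)} {J : Finset (Fin (n + 1))} (hj : j ∉ J) :
    (tAmat n).toCoxeterSystem.simple '' (↑J : Set (Fin (n + 1))) =
      (fun k => (tAmat n).toCoxeterSystem.simple (cyc n j k)) '' (cutAt n j J) := by
  conv_lhs => rw [← image_cyc_cutAt hj, Finset.coe_image, Set.image_image]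

lemma finite_parabolic_tAmat {n : ℕ} (hn : 2 ≤ n) {J : Finset (Fin (n + 1))}
    (hJ : J ≠ Finset.univ) :
    (parabolic (tAmat n).toCoxeterSystem (↑J : Set (Fin (n + 1))) : Set (tAmat n).Group).Finite := by
  obtain ⟨j, hj⟩ : ∃ j, j ∉ J := by
    by_contra! h
    exact hJ (Finset.eq_univ_of_forall h)
  exact (isLabelledPath_tAmat (Nat.lt_succ_iff.1 j.2)).finite_parabolic (isSwapLabelling_tAmat hn)
    (Finset.filter_subset _ _) (simple_image_cutAt hj)

lemma affTerm_eq {n : ℕ} (hn : 2 ≤ n) {j : Fin (n + 1)} {J : Finset (Fin (n + 1))} (hj : j ∉ J) :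
    affTerm n J = pathTerm n (cutAt n j J) := by
  have hsub : cutAt n j J ⊆ Finset.range n := Finset.filter_subset _ _
  have hcard : J.card = (cutAt n j J).card := by
    conv_lhs => rw [← image_cyc_cutAt hj]
    refine Finset.card_image_of_injOn fun k hk l hl e => ?_
    exact cyc_injOn (Nat.lt_succ_iff.1 j.2) (Finset.mem_range.1 (hsub hk)).le
      (Finset.mem_range.1 (hsub hl)).le e
  rw [affTerm, pathTerm, hcard, (isLabelledPath_tAmat (Nat.lt_succ_iff.1 j.2)).length_w0
    (isSwapLabelling_tAmat hn) hsub (simple_image_cutAt hj)]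

lemma sum_affTerm {n : ℕ} (hn : 2 ≤ n) (j : Fin (n + 1)) (p : Finset (Fin (n + 1)) → Prop)
    (q : Finset ℕ → Prop) [DecidablePred p] [DecidablePred q]
    (hp : ∀ J, p J → j ∉ J) (hpq : ∀ J, j ∉ J → (p J ↔ q (cutAt n j J))) :
    ∑ J with p J, affTerm n J = ∑ K ∈ (Finset.range n).powerset with q K, pathTerm n K := by
  refine Finset.sum_nbij' (cutAt n j) (fun K => K.image (cyc n j)) ?_ ?_ ?_ ?_ ?_
  · intro J hJ
    have hpJ := (Finset.mem_filter.1 hJ).2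
    exact Finset.mem_filter.2 ⟨Finset.mem_powerset.2 (Finset.filter_subset _ _),
      (hpq J (hp J hpJ)).1 hpJ⟩
  · intro K hK
    obtain ⟨hK, hqK⟩ := Finset.mem_filter.1 hK
    rw [Finset.mem_powerset] at hK
    refine Finset.mem_filter.2 ⟨Finset.mem_univ _, (hpq _ (notMem_image_cyc hK)).2 ?_⟩
    rwa [cutAt_image_cyc hK]
  · intro J hJ
    exact image_cyc_cutAt (hp J (Finset.mem_filter.1 hJ).2)
  · intro K hK
    exact cutAt_image_cyc (Finset.mem_powerset.1 (Finset.mem_filter.1 hK).1)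
  · intro J hJ
    exact affTerm_eq hn (hp J (Finset.mem_filter.1 hJ).2)

/-- The least element of the complement of `J`. -/
noncomputable def firstGap {n : ℕ} (J : Finset (Fin (n + 1))) : ℕ :=
  sInf {m | ∃ j : Fin (n + 1), j ∉ J ∧ (j : ℕ) = m}

lemma firstGap_eq_iff {n : ℕ} {J : Finset (Fin (n + 1))} {j : Fin (n + 1)} (hJ : J ≠ Finset.univ) :
    firstGap J = j ↔ j ∉ J ∧ ∀ i < j, i ∈ J := by
  have hne : {m | ∃ j : Fin (n + 1), j ∉ J ∧ (j : ℕ) = m}.Nonempty := by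
    by_contra h
    rw [Set.not_nonempty_iff_eq_empty] at h
    refine hJ (Finset.eq_univ_of_forall fun i => ?_)
    by_contra hi
    exact (h ▸ (⟨i, hi, rfl⟩ : (i : ℕ) ∈ {m | ∃ j : Fin (n + 1), j ∉ J ∧ (j : ℕ) = m}) :
      (i : ℕ) ∈ (∅ : Set ℕ))
  constructor
  · intro h
    obtain ⟨i, hi, e⟩ := Nat.sInf_mem hne
    obtain rfl : i = j := Fin.ext (e.trans h)
    refine ⟨hi, fun l hl => ?_⟩
    by_contra hlJ
    refine Nat.notMem_of_lt_sInf (s := {m | ∃ j : Fin (n + 1), j ∉ J ∧ (j : ℕ) = m}) (m := l) ?_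
      ⟨l, hlJ, rfl⟩
    change (l : ℕ) < firstGap J
    rw [h]
    exact hl
  · rintro ⟨hj, h⟩
    refine le_antisymm (Nat.sInf_le ⟨j, hj, rfl⟩) ?_
    obtain ⟨i, hi, e⟩ := Nat.sInf_mem hne
    change (j : ℕ) ≤ sInf _
    rw [← e]
    by_contra! hlt
    exact hi (h i hlt)

lemma firstGap_lt {n : ℕ} {J : Finset (Fin (n + 1))} (hJ : J ≠ Finset.univ)
    (hn : Fin.last n ∈ J) : firstGap J < n := by
  obtain ⟨j, hj⟩ : ∃ j, j ∉ J := by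
    by_contra! h
    exact hJ (Finset.eq_univ_of_forall h)
  have h1 : firstGap J ≤ j := Nat.sInf_le ⟨j, hj, rfl⟩
  have h2 : j ≠ Fin.last n := fun h => hj (h ▸ hn)
  exact h1.trans_lt (Fin.val_lt_last h2)

lemma succ_le_run_cutAt_iff {n : ℕ} {j : Fin (n + 1)} (hjn : (j : ℕ) < n)
    {J : Finset (Fin (n + 1))} :
    (j : ℕ) + 1 ≤ run (cutAt n j J) n ↔ Fin.last n ∈ J ∧ ∀ i < j, i ∈ J := by
  rw [le_run_iff]
  simp only [cutAt, Finset.mem_filter, Finset.mem_range]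
  have hval : ∀ k < n, (cyc n j k : ℕ) = if (j : ℕ) + 1 + k ≤ n then (j : ℕ) + 1 + k else j + k - n :=
    fun k hk => val_cyc hjn.le hk.le
  constructor
  · rintro ⟨-, h⟩
    refine ⟨?_, fun i hi => ?_⟩
    · have e : cyc n j (n - j - 1) = Fin.last n := Fin.ext (by
        rw [hval _ (by omega), Fin.val_last]
        split_ifs <;> omega)
      exact e ▸ (h (n - j - 1) (by omega) (by omega)).2
    · have hi' : (i : ℕ) < j := hi
      have e : cyc n j (n - j + i) = i := Fin.ext (by
        rw [hval _ (by omega)]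
        split_ifs <;> omega)
      exact e ▸ (h (n - j + i) (by omega) (by omega)).2
  · rintro ⟨h1, h2⟩
    refine ⟨hjn, fun k hk hkj => ⟨hk, ?_⟩⟩
    rcases eq_or_ne ((j : ℕ) + 1 + k) n with h | h
    · have e : cyc n j k = Fin.last n := Fin.ext (by
        rw [hval _ hk, Fin.val_last]
        split_ifs <;> omega)
      rwa [e]
    · refine h2 _ (Fin.lt_def.2 ?_)
      rw [hval _ hk]
      split_ifs <;> omega

lemma finite_parabolic_tAmat_iff {n : ℕ} (hn : 2 ≤ n) {J : Finset (Fin (n + 1))} :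
    (parabolic (tAmat n).toCoxeterSystem (↑J : Set (Fin (n + 1))) : Set (tAmat n).Group).Finite ↔
      J ≠ Finset.univ := by
  refine ⟨?_, finite_parabolic_tAmat hn⟩
  rintro h rfl
  rw [parabolic, Finset.coe_univ, Set.image_univ, CoxeterSystem.subgroup_closure_range_simple] at h
  have := infinite_of_isSwapLabelling (tAmat n).toCoxeterSystem _ (isSwapLabelling_tAmat hn)
  exact Set.infinite_univ h

lemma chiAffA_eq {n : ℕ} (hn : 2 ≤ n) :
    chiAffA n = ∑ J : Finset (Fin (n + 1)) with J ≠ Finset.univ, affTerm n J := by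
  rw [chiAffA, ← finsum_mem_coe_finset]
  refine finsum_mem_congr ?_ fun _ _ => rfl
  ext J
  rw [Set.mem_ofPred_eq, finite_parabolic_tAmat_iff hn]
  simp

end Sums

/-- for `n ≥ 2`, every proper parabolic subgroup of `Ãₙ` is finite
(hence `χ̂_{Ãₙ}` is a polynomial), and
`χ̂_{Ãₙ}(q) = χ̂_{Aₙ}(q) + Σ_{k=1}^{n} k·(-1)^k q^(C(k+1,2)) χ̂_{A_{n-k-1}}(q)`
(with `χ̂_{A_i} = 1` for `i ≤ 0`). -/
theorem chiAff_tA (n : ℕ) (hn : 2 ≤ n) :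
    (∀ J : Finset (Fin (n + 1)), J ≠ Finset.univ →
      ((parabolic (tAmat n).toCoxeterSystem (↑J : Set (Fin (n + 1)))) :
        Set (tAmat n).Group).Finite) ∧
    chiAffA n = chiA n +
      ∑ k ∈ Finset.Icc 1 n,
        (k : Polynomial ℤ) * (-1) ^ k * X ^ (k + 1).choose 2 * chiA (n - k - 1) := by
  refine ⟨fun J hJ => finite_parabolic_tAmat hn hJ, ?_⟩
  rw [chiAffA_eq hn, ← Finset.sum_filter_add_sum_filter_not _ (fun J => Fin.last n ∉ J),
    Finset.filter_filter, Finset.filter_filter, ← sum_pathTerm_le_run]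
  congr 1
  · rw [sum_affTerm hn (Fin.last n) _ (fun _ => True) (fun J hJ => hJ.2), chiA_eq,
      Finset.filter_true]
    intro J hJ
    simp only [hJ, not_false_eq_true, and_true, iff_true]
    rintro rfl
    exact hJ (Finset.mem_univ _)
  · rw [← Finset.sum_fiberwise_of_maps_to (t := Finset.range n) (g := firstGap)]
    · refine Finset.sum_congr rfl fun m hm => ?_
      rw [Finset.mem_range] at hm
      obtain ⟨j, rfl⟩ : ∃ j : Fin (n + 1), (j : ℕ) = m := ⟨⟨m, by omega⟩, rfl⟩
      rw [Finset.filter_filter]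
      refine sum_affTerm hn j _ _ (fun J hJ => ((firstGap_eq_iff hJ.1.1).1 hJ.2).1) fun J hJ => ?_
      have hne : J ≠ Finset.univ := by
        rintro rfl
        exact hJ (Finset.mem_univ _)
      rw [succ_le_run_cutAt_iff hm, firstGap_eq_iff hne]
      simp only [hne, hJ, ne_eq, not_false_eq_true, true_and, not_not]
    · intro J hJ
      simp only [Finset.mem_filter, Finset.mem_univ, true_and, not_not] at hJ
      exact Finset.mem_range.2 (firstGap_lt hJ.1 hJ.2)

end CoxeterCharPoly
end
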